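/- arXiv:1002.2786 — 4 statements merged into one kernel-verified Lean document; each statement's English description precedes it below -/
import Mathlib

section
/- Fix any k > 0. There is no partial recursive function g on (k+2)-tuples of natural numbers such that: for all n, x_0, …, x_k ∈ ℕ satisfying {x_0, …, x_k} ⊄ W_n, the computation g(n, x_0, …, x_k) halts and outputs some x_i ∈ {x_0, …, x_k} with the property that {x_0, …, x_k} \ {x_i} ⊄ W_n. That is, given a recursively enumerable set W_n and a finite set F ⊄ W_n, one cannot in general recursively find a proper subset A ⊂ F with A ⊄ W_n. -/
/-- The `n`-th recursively enumerable set: the domain of the `n`-th partial recursive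
function under the canonical numbering. -/
def W (n : ℕ) : Set ℕ := {x | ((Denumerable.ofNat Nat.Partrec.Code n).eval x).Dom}

open Nat.Partrec in
/-- For a partial recursive `g` there is a code `c` halting on exactly those inputs `y` which differ
from the value of `g` at `c` followed by the list `l`, provided that this value is at most `k`. -/
theorem exists_code_dom_iff_ne_output {g : ℕ →. ℕ} (hg : Nat.Partrec g) (k : ℕ) (l : List ℕ) :
    ∃ c : Code, ∀ y, (c.eval y).Dom ↔
      ∃ v ∈ g (Encodable.encode (Encodable.encode c :: l)), v ≤ k ∧ y ≠ v := by
  let f : Code → ℕ →. ℕ := fun c y =>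
    (g (Encodable.encode (Encodable.encode c :: l))).bind fun v =>
      ((if v ≤ k ∧ y ≠ v then some 0 else none : Option ℕ) : Part ℕ)
  have hf : Partrec₂ f := by
    refine Partrec.bind ((Partrec.nat_iff.2 hg).comp ?_) (Computable.ofOption ?_)
    · exact (Primrec.encode.comp (Primrec.list_cons.comp
        (Primrec.encode.comp Primrec.fst) (Primrec.const l))).to_comp
    · exact (Primrec.ite
        ((Primrec.nat_le.comp Primrec.snd (Primrec.const k)).and
          (Primrec.eq.comp (Primrec.snd.comp Primrec.fst) Primrec.snd).not)
        (Primrec.const _) (Primrec.const _)).to_comp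
  obtain ⟨c, hc⟩ := Code.fixed_point₂ hf
  refine ⟨c, fun y => ?_⟩
  rw [hc, Part.dom_iff_mem]
  simp [f]

/-- Lemma 3.4 (Chiodo): for any `k > 0` there is no partial recursive function which,
given `n, x₀, …, x_k` with `{x₀, …, x_k} ⊄ W_n`, halts and outputs some `x i` such that
the remaining values `{x₀, …, x̂ᵢ, …, x_k}` still do not all lie in `W_n`. -/
theorem no_recursive_subset_avoider (k : ℕ) (hk : 0 < k) :
    ¬ ∃ g : ℕ →. ℕ, Nat.Partrec g ∧
      ∀ (n : ℕ) (x : Fin (k + 1) → ℕ),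
        ¬ (∀ i, x i ∈ W n) →
        ∃ i : Fin (k + 1),
          x i ∈ g (Encodable.encode (n :: List.ofFn x)) ∧
          ¬ (∀ j, j ≠ i → x j ∈ W n) := by
  rintro ⟨g, hg, H⟩
  let x : Fin (k + 1) → ℕ := fun i => i
  obtain ⟨c, hc⟩ := exists_code_dom_iff_ne_output hg k (List.ofFn x)
  have hW : ∀ y, y ∈ W (Encodable.encode c) ↔
      ∃ v ∈ g (Encodable.encode (Encodable.encode c :: List.ofFn x)), v ≤ k ∧ y ≠ v := by
    intro y
    simp only [W, Set.mem_ofPred_eq, Denumerable.ofNat_encode, hc]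
  obtain ⟨i, hi, hj⟩ := H (Encodable.encode c) x fun h => by
    obtain ⟨v, hv, hvk, -⟩ := (hW _).1 (h 0)
    obtain ⟨w, hw, -, hne⟩ := (hW _).1 (h ⟨v, by omega⟩)
    exact hne (Part.mem_unique hv hw)
  exact hj fun j hji => (hW _).2 ⟨_, hi, Nat.le_of_lt_succ i.2, fun h => hji (Fin.ext h)⟩
end

section
/- Fix any k > 0. There is no partial recursive function g on (k+2)-tuples of natural numbers such that: for all n, x_0, …, x_k ∈ ℕ satisfying |{x_0, …, x_k} ∩ W_n| ≤ 1, the computation g(n, x_0, …, x_k) halts and outputs some x_i ∈ {x_0, …, x_k} with x_i ∉ W_n. That is, given a recursively enumerable set W_n and a finite set F with |F ∩ W_n| ≤ 1, one cannot in general recursively find an element of F not lying in W_n. -/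
open Nat.Partrec in
/-- By the recursion theorem, an index-dependent partial recursive computation `h` has an index `n`
at which the `n`-th recursively enumerable set consists of exactly the output of `h n`. -/
theorem exists_W_eq_output {h : ℕ →. ℕ} (hh : Partrec h) : ∃ n, W n = {y | y ∈ h n} := by
  have hf : Partrec₂ fun (c : Code) (y : ℕ) =>
      (h (Encodable.encode c)).bind fun v => ((if v = y then some 0 else none : Option ℕ) : Part ℕ) := by
    refine Partrec.bind (hh.comp (Computable.encode.comp Computable.fst)) ?_
    refine Computable.ofOption (Primrec.to_comp ?_)
    exact Primrec.ite (Primrec.eq.comp Primrec.snd (Primrec.snd.comp Primrec.fst))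
      (Primrec.const _) (Primrec.const _)
  obtain ⟨c, hc⟩ := Code.fixed_point₂ hf
  refine ⟨Encodable.encode c, Set.ext fun y => ?_⟩
  simp only [W, Denumerable.ofNat_encode, hc, Set.mem_ofPred_eq, Part.dom_iff_mem, Part.mem_bind_iff,
    Part.mem_ofOption, Option.mem_def]
  constructor
  · rintro ⟨_, v, hv, hvy⟩
    split_ifs at hvy with e
    exact e ▸ hv
  · exact fun hy => ⟨0, y, hy, if_pos rfl⟩

/-- Lemma 3.5 (Chiodo): for any `k > 0` there is no partial recursive function which,
given `n, x₀, …, x_k` with `|{x₀, …, x_k} ∩ W_n| ≤ 1`, halts and outputs some `x i`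
not lying in `W_n`. -/
theorem no_recursive_nonmember_picker (k : ℕ) (hk : 0 < k) :
    ¬ ∃ g : ℕ →. ℕ, Nat.Partrec g ∧
      ∀ (n : ℕ) (x : Fin (k + 1) → ℕ),
        (Set.range x ∩ W n).Subsingleton →
        ∃ i : Fin (k + 1),
          x i ∈ g (Encodable.encode (n :: List.ofFn x)) ∧ x i ∉ W n := by
  rintro ⟨g, hg, hpick⟩
  let x : Fin (k + 1) → ℕ := fun i => i
  obtain ⟨n, hn⟩ := exists_W_eq_output
    (h := fun n => g (Encodable.encode (n :: List.ofFn x)))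
    ((Partrec.nat_iff.2 hg).comp
      (Computable.encode.comp (Computable.list_cons.comp Computable.id (Computable.const _))))
  obtain ⟨i, hi, hiW⟩ := hpick n x (by
    rw [hn]
    exact fun a ha b hb => Part.mem_unique ha.2 hb.2)
  rw [hn] at hiW
  exact hiW hi
end

section
/- Fix any k > 0. There is no algorithm (partial recursive function on codes) that, on input of a code of a (k+1)-tuple of finite presentations P_0, …, P_k such that at least one P_i presents a nontrivial group, halts and outputs an index i ∈ {0, …, k} such that among the remaining k presentations P_0, …, P_{i-1}, P_{i+1}, …, P_k at least one presents a nontrivial group. -/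
/-- A word in `m` generators. -/
abbrev Word (m : ℕ) : Type := List (Fin m × Bool)

/-- A finite presentation: a number of generators together with a finite list of relator words. -/
abbrev FinPres : Type := Σ m : ℕ, List (Word m)

/-- The set of relators of a finite presentation, as elements of the free group. -/
def FinPres.rels (P : FinPres) : Set (FreeGroup (Fin P.1)) :=
  {x | ∃ r ∈ P.2, x = FreeGroup.mk r}

/-- The group presented by a finite presentation. -/
abbrev FinPres.Grp (P : FinPres) : Type := PresentedGroup P.rels

/-- The projection from the free group onto the presented group. -/
def FinPres.proj (P : FinPres) : FreeGroup (Fin P.1) →* P.Grp :=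
  PresentedGroup.mk P.rels

/-- The set of orders of nontrivial torsion elements of a group. -/
def TorOrd (G : Type*) [Group G] : Set ℕ := {n | 2 ≤ n ∧ ∃ g : G, orderOf g = n}

namespace TrivialityProblem

open Monoid Function

theorem coprodI_to_pushout_injective {ι H : Type*} {G A : ι → Type*} [∀ i, Group (G i)]
    [∀ i, Group (A i)] [Group H] {φ : ∀ i, H →* G i} (hφ : ∀ i, Injective (φ i))
    (ψ : ∀ i, A i →* G i) (hψ : ∀ i a, ψ i a ∈ (φ i).range → a = 1) :
    Injective (CoprodI.lift fun i => (PushoutI.of i).comp (ψ i) :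
      CoprodI A →* PushoutI φ) := by
  classical
  rw [injective_iff_map_eq_one]
  intro w hw
  obtain ⟨wd, rfl⟩ : ∃ wd : CoprodI.Word A, wd.prod = w :=
    ⟨CoprodI.Word.equiv w, CoprodI.Word.equiv.symm_apply_apply w⟩
  let wd' : CoprodI.Word G :=
    { toList := wd.toList.map fun a => ⟨a.1, ψ a.1 a.2⟩
      ne_one := by
        intro l hl h1
        obtain ⟨a, ha, rfl⟩ := List.mem_map.1 hl
        have h1' : ψ a.1 a.2 = 1 := h1
        exact wd.ne_one a ha (hψ _ _ (by rw [h1']; exact one_mem _))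
      chain_ne := by
        have := wd.chain_ne
        rw [List.isChain_map]
        exact this }
  have hred : PushoutI.Reduced φ wd' := by
    intro l hl hmem
    obtain ⟨a, ha, rfl⟩ := List.mem_map.1 hl
    exact wd.ne_one a ha (hψ _ _ hmem)
  have hprod : PushoutI.ofCoprodI wd'.prod = (1 : PushoutI φ) := by
    rw [← hw]
    simp [CoprodI.Word.prod, wd', map_list_prod, List.map_map, comp_def]
  have := hred.eq_empty_of_mem_range hφ (hprod ▸ one_mem _)
  have h0 : wd'.toList = [] := by rw [this]; rfl
  have h1 : wd.toList = [] := by simpa [wd'] using h0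
  simp [CoprodI.Word.prod, h1]

/-- The free group of rank two, as a free product of two infinite cyclic groups. -/
abbrev FreeTwo : Type := CoprodI fun _ : Bool => Multiplicative ℤ

/-- The two standard generators of `FreeTwo`. -/
def FreeTwo.gen (b : Bool) : FreeTwo :=
  CoprodI.of (M := fun _ : Bool => Multiplicative ℤ) (i := b) (Multiplicative.ofAdd 1)

theorem FreeTwo.gen_def (b : Bool) : FreeTwo.gen b =
  CoprodI.of (M := fun _ : Bool => Multiplicative ℤ) (i := b) (Multiplicative.ofAdd 1) := rfl

/-- The permutation `q ↦ q + 1` of the rationals. -/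
def shiftPerm : Equiv.Perm ℚ := Equiv.addRight 1

/-- The permutation `q ↦ q / 2` of the rationals. -/
def halfPerm : Equiv.Perm ℚ := Equiv.mulRight₀ (2⁻¹ : ℚ) (by norm_num)

theorem shiftPerm_zpow (n : ℤ) (q : ℚ) : (shiftPerm ^ n) q = q + n := by
  simp [shiftPerm]

theorem halfPerm_zpow (n : ℤ) (q : ℚ) : (halfPerm ^ n) q = q * 2⁻¹ ^ n := by
  induction n using Int.induction_on generalizing q with
  | zero => simp
  | succ n ih =>
    rw [zpow_add_one, Equiv.Perm.mul_apply, ih, zpow_add_one₀ (by norm_num)]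
    simp [halfPerm]; ring
  | pred n ih =>
    rw [zpow_sub_one, Equiv.Perm.mul_apply, ih, zpow_sub_one₀ (by norm_num)]
    simp [halfPerm, Equiv.Perm.inv_def]; ring

theorem half_inv_shift_half : halfPerm⁻¹ * shiftPerm * halfPerm = shiftPerm ^ 2 := by
  ext q
  simp [halfPerm, shiftPerm, pow_two, Equiv.Perm.inv_def]
  ring

theorem exists_free_pair : ∃ (Q : Type) (_ : Group Q) (ψ : FreeTwo →* Q) (s : Q),
    Injective ψ ∧ s⁻¹ * ψ (.gen false) * s = ψ (.gen false) ^ 2 ∧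
      (ψ (.gen true))⁻¹ * s * ψ (.gen true) = s ^ 2 := by
  let φ : Bool → Multiplicative ℤ →* Equiv.Perm ℚ :=
    fun b => zpowersHom _ (cond b shiftPerm halfPerm)
  let χ : Bool → Multiplicative ℤ →* Equiv.Perm ℚ :=
    fun b => zpowersHom _ (cond b halfPerm shiftPerm)
  have hφ : ∀ b, Injective (φ b) := by
    intro b
    rw [injective_iff_map_eq_one]
    intro a ha
    cases b
    · have := DFunLike.congr_fun ha 1
      simp only [φ, cond_false, zpowersHom_apply, halfPerm_zpow, Equiv.Perm.one_apply,
        one_mul] at this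
      have := (zpow_eq_one_iff_right₀ (by norm_num) (by norm_num)).1 this
      exact this
    · have := DFunLike.congr_fun ha 0
      simp only [φ, cond_true, zpowersHom_apply, shiftPerm_zpow, Equiv.Perm.one_apply] at this
      simpa using this
  have hχ : ∀ b a, χ b a ∈ (φ b).range → a = 1 := by
    rintro b a ⟨c, hc⟩
    cases b
    · have := DFunLike.congr_fun hc 0
      simp only [φ, χ, cond_false, zpowersHom_apply, halfPerm_zpow, shiftPerm_zpow] at this
      simpa using this.symm
    · have h0 := DFunLike.congr_fun hc 0
      have h1 := DFunLike.congr_fun hc 1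
      simp only [φ, χ, cond_true, zpowersHom_apply, halfPerm_zpow, shiftPerm_zpow] at h0 h1
      have h2 : (2⁻¹ : ℚ) ^ (Multiplicative.toAdd a) = 1 := by linarith
      exact (zpow_eq_one_iff_right₀ (by norm_num) (by norm_num)).1 h2
  refine ⟨PushoutI φ, inferInstance, CoprodI.lift fun i => (PushoutI.of i).comp (χ i),
    PushoutI.base φ (Multiplicative.ofAdd 1), coprodI_to_pushout_injective hφ χ hχ, ?_, ?_⟩
  · rw [← PushoutI.of_apply_eq_base φ false]
    simp only [FreeTwo.gen_def, CoprodI.lift_of, MonoidHom.comp_apply, ← map_inv,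
      ← map_mul, ← map_pow]
    simp [φ, χ, half_inv_shift_half]
  · rw [← PushoutI.of_apply_eq_base φ true]
    simp only [FreeTwo.gen_def, CoprodI.lift_of, MonoidHom.comp_apply, ← map_inv,
      ← map_mul, ← map_pow]
    simp [φ, χ, half_inv_shift_half]

theorem exists_overgroup_conj_sq {U : Type} [Group U] (ψ : FreeTwo →* U) (hψ : Injective ψ) :
    ∃ (U' : Type) (_ : Group U') (f : U →* U') (s : U'), Injective f ∧
      s⁻¹ * f (ψ (.gen false)) * s = f (ψ (.gen false)) ^ 2 ∧
      (f (ψ (.gen true)))⁻¹ * s * f (ψ (.gen true)) = s ^ 2 := by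
  obtain ⟨Q, _, χ, s, hχ, h1, h2⟩ := exists_free_pair
  let G : Bool → Type := fun b => cond b Q U
  let _ : ∀ b, Group (G b) := fun b => by cases b <;> dsimp [G] <;> infer_instance
  let φ : ∀ b, FreeTwo →* G b := fun b => match b with
    | true => χ
    | false => ψ
  have hφ : ∀ b, Injective (φ b) := by rintro (_ | _) <;> assumption
  have key (x : FreeTwo) : PushoutI.of (φ := φ) false (ψ x) = PushoutI.of (φ := φ) true (χ x) :=
    (PushoutI.of_apply_eq_base φ false x).trans (PushoutI.of_apply_eq_base φ true x).symm
  refine ⟨PushoutI φ, inferInstance, PushoutI.of (φ := φ) false, PushoutI.of (φ := φ) true s,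
    PushoutI.of_injective hφ false, ?_, ?_⟩
  · rw [key, ← map_inv, ← map_mul, ← map_mul, ← map_pow]
    exact congrArg _ h1
  · rw [key, ← map_inv, ← map_mul, ← map_mul, ← map_pow]
    exact congrArg _ h2

theorem exists_overgroup_conj_sq_finset {J : Type*} (T : Finset J) {U : Type} [Group U]
    (ψ : J → FreeTwo →* U) (hψ : ∀ j, Injective (ψ j)) :
    ∃ (U' : Type) (_ : Group U') (f : U →* U') (s : J → U'), Injective f ∧ ∀ j ∈ T,
      (s j)⁻¹ * f (ψ j (.gen false)) * s j = f (ψ j (.gen false)) ^ 2 ∧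
      (f (ψ j (.gen true)))⁻¹ * s j * f (ψ j (.gen true)) = s j ^ 2 := by
  classical
  induction T using Finset.induction_on with
  | empty => exact ⟨U, inferInstance, .id U, fun _ => 1, injective_id, by simp⟩
  | insert j T hj ih =>
    obtain ⟨U₁, _, f₁, s₁, hf₁, h₁⟩ := ih
    obtain ⟨U₂, _, f₂, s₂, hf₂, h₂⟩ :=
      exists_overgroup_conj_sq (f₁.comp (ψ j)) (hf₁.comp (hψ j))
    refine ⟨U₂, inferInstance, f₂.comp f₁, fun i => if i = j then s₂ else f₂ (s₁ i),
      hf₂.comp hf₁, fun i hi => ?_⟩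
    obtain rfl | hi := Finset.mem_insert.1 hi
    · simpa using h₂
    · have hij : i ≠ j := fun h => hj (h ▸ hi)
      simpa [hij] using And.intro (congrArg f₂ (h₁ i hi).1) (congrArg f₂ (h₁ i hi).2)

/-- For `w` of infinite order and a letter `a` freely adjoined, each pair `(y * a, w)` generates
a free group of rank two. -/
theorem exists_free_letter {G : Type} [Group G] (w : G) (hw : ∀ n : ℤ, w ^ n = 1 → n = 0) :
    ∃ (U : Type) (_ : Group U) (f : G →* U) (a : U), Injective f ∧
      ∀ y : G, ∃ ψ : FreeTwo →* U, Injective ψ ∧ ψ (.gen false) = f y * a ∧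
        ψ (.gen true) = f w := by
  let A : Bool → Type := fun b => cond b G (Multiplicative ℤ)
  let _ : ∀ b, Group (A b) := fun b => by cases b <;> dsimp [A] <;> infer_instance
  let φ : ∀ b, Unit →* A b := fun b => 1
  have hφ : ∀ b, Injective (φ b) := fun b => injective_of_subsingleton _
  let χ : ∀ b, Multiplicative ℤ →* A b := fun b => match b with
    | true => zpowersHom G w
    | false => .id _
  have hχ : ∀ b a, χ b a ∈ (φ b).range → a = 1 := by
    rintro b a ⟨c, hc⟩
    cases b
    · exact hc.symm
    · exact hw a hc.symm
  have hinj := coprodI_to_pushout_injective hφ χ hχ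
  let f : G →* PushoutI φ := PushoutI.of (φ := φ) true
  let a : PushoutI φ := PushoutI.of (φ := φ) false (Multiplicative.ofAdd (1 : ℤ))
  refine ⟨PushoutI φ, inferInstance, f, a, PushoutI.of_injective hφ true, fun y => ?_⟩
  have endo (y : G) : ∃ e : PushoutI φ →* PushoutI φ, (∀ g, e (f g) = f g) ∧ e a = f y * a := by
    let k : ∀ b, A b →* PushoutI φ := fun b => match b with
      | true => f
      | false => zpowersHom (PushoutI φ) (f y * a)
    refine ⟨PushoutI.lift k 1 fun b => MonoidHom.ext fun u => by simp [φ], fun g => ?_, ?_⟩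
    · exact PushoutI.lift_of (i := true) ..
    · refine (PushoutI.lift_of (i := false) ..).trans ?_
      exact zpow_one (f y * a)
  obtain ⟨e, he, hea⟩ := endo y
  obtain ⟨e', he', hea'⟩ := endo y⁻¹
  refine ⟨e.comp (CoprodI.lift fun i => (PushoutI.of i).comp (χ i)), ?_, ?_, ?_⟩
  · rw [MonoidHom.coe_comp]
    refine Injective.comp (f := _) (LeftInverse.injective (g := e') (f := e) fun x => ?_) hinj
    have : e'.comp e = .id _ := by
      refine PushoutI.hom_ext_nonempty fun b => ?_
      cases b
      · refine MonoidHom.ext_mint ?_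
        change e' (e a) = a
        rw [hea, map_mul, he', hea', ← mul_assoc, ← map_mul]
        simp
      · ext g
        change e' (e (f g)) = f g
        rw [he, he']
    exact DFunLike.congr_fun this x
  · rw [FreeTwo.gen_def, MonoidHom.comp_apply, CoprodI.lift_of]
    exact hea
  · rw [FreeTwo.gen_def, MonoidHom.comp_apply, CoprodI.lift_of]
    refine (congrArg (fun z => e (f z)) (zpow_one w)).trans (he w)

theorem exists_equiv_map_pair {X Y : Type*} (e : X ≃ Y) {x₁ x₀ : X} {y₁ y₀ : Y} (hx : x₁ ≠ x₀)
    (hy : y₁ ≠ y₀) : ∃ e' : X ≃ Y, e' x₁ = y₁ ∧ e' x₀ = y₀ := by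
  classical
  let e₁ := e.trans (Equiv.swap (e x₁) y₁)
  have h₁ : e₁ x₁ = y₁ := by simp [e₁]
  refine ⟨e₁.trans (Equiv.swap (e₁ x₀) y₀), ?_, by simp⟩
  rw [Equiv.trans_apply, h₁, Equiv.swap_apply_of_ne_of_ne _ hy]
  rw [← h₁]
  exact e₁.injective.ne hx

/-- Right translation on functions on a group. -/
def rightShift (K C : Type*) [Group K] : K →* Equiv.Perm (K → C) where
  toFun g :=
    { toFun := fun f k => f (k * g)
      invFun := fun f k => f (k * g⁻¹)
      left_inv := fun f => by simp
      right_inv := fun f => by simp }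
  map_one' := by ext; simp
  map_mul' a b := by ext; simp [mul_assoc]

theorem rightShift_apply {K C : Type*} [Group K] (g : K) (f : K → C) (k : K) :
    rightShift K C g f k = f (k * g) :=
  rfl

theorem nonempty_quotient_arrow_equiv {K Q : Type} [Infinite K] (π : K → Q)
    (hπ : Surjective π) : Nonempty ((Q → K → Bool) ≃ (K → Bool)) := by
  have : Nonempty Q := ⟨π (Classical.arbitrary K)⟩
  have h : Cardinal.mk (Q × K) = Cardinal.mk K := by
    rw [Cardinal.mk_prod, Cardinal.lift_id, Cardinal.lift_id]
    exact Cardinal.mul_eq_right (Cardinal.aleph0_le_mk K) (Cardinal.mk_le_of_surjective hπ)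
      (Cardinal.mk_ne_zero Q)
  obtain ⟨e⟩ := Cardinal.eq.1 h
  exact ⟨(Equiv.curry Q K Bool).symm.trans (e.arrowCongr (Equiv.refl Bool))⟩

open Classical in
/-- The functions on `K` are, as an `α.range`-space, the functions on `Λ`, compatibly with the
indicator functions of a subgroup. -/
theorem exists_equivariant_restrict {K Λ : Type} [Group K] [Infinite K] [Group Λ]
    (T : Subgroup K) (α : Λ →* K) (hα : Injective α) {c₁ c₀ : K → Bool} (hc : c₁ ≠ c₀) :
    ∃ E : (K → K → Bool) ≃ (Λ → K → Bool),
      (∀ l f, E (rightShift K _ (α l) f) = rightShift Λ _ l (E f)) ∧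
      E (fun k => if k ∈ T then c₁ else c₀) = fun l => if α l ∈ T then c₁ else c₀ := by
  have hs (q : K ⧸ α.range) :
      ∃ k : K, (k : K ⧸ α.range) = q ∧ ((∃ t ∈ T, (t : K ⧸ α.range) = q) → k ∈ T) := by
    by_cases h : ∃ t ∈ T, (t : K ⧸ α.range) = q
    · exact ⟨h.choose, h.choose_spec.2, fun _ => h.choose_spec.1⟩
    · obtain ⟨k, rfl⟩ := QuotientGroup.mk_surjective q
      exact ⟨k, rfl, fun h' => (h h').elim⟩
  choose s hsq hsT using hs
  have hmk (q : K ⧸ α.range) (l : Λ) : ((s q * α l : K) : K ⧸ α.range) = q := by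
    rw [QuotientGroup.mk_mul_of_mem _ (MonoidHom.mem_range.2 ⟨l, rfl⟩), hsq]
  have hbij : Bijective fun x : Λ × (K ⧸ α.range) => s x.2 * α x.1 := by
    constructor
    · rintro ⟨l, q⟩ ⟨l', q'⟩ h
      have hq : q = q' := by
        rw [← hmk q l, ← hmk q' l']
        exact congrArg _ h
      subst hq
      exact Prod.ext (hα (mul_left_cancel h)) rfl
    · intro k
      obtain ⟨l, hl⟩ := QuotientGroup.eq.1 (hsq (k : K ⧸ α.range))
      exact ⟨(l, k), by simp [hl]⟩
  let d₁ : (K ⧸ α.range) → K → Bool := fun q => if s q ∈ T then c₁ else c₀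
  let d₀ : (K ⧸ α.range) → K → Bool := fun _ => c₀
  have hd : d₁ ≠ d₀ := by
    intro h
    have := congrFun h ((1 : K) : K ⧸ α.range)
    simp only [d₁, d₀, if_pos (hsT _ ⟨1, T.one_mem, rfl⟩)] at this
    exact hc this
  obtain ⟨e₀⟩ := nonempty_quotient_arrow_equiv (K := K) (Q := K ⧸ α.range) _
    QuotientGroup.mk_surjective
  obtain ⟨e, he₁, he₀⟩ := exists_equiv_map_pair e₀ hd hc
  let E : (K → K → Bool) ≃ (Λ → K → Bool) :=
    ((Equiv.ofBijective _ hbij).symm.arrowCongr (Equiv.refl _)).trans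
      ((Equiv.curry Λ (K ⧸ α.range) (K → Bool)).trans ((Equiv.refl Λ).arrowCongr e))
  have hE (f : K → K → Bool) (l : Λ) : E f l = e fun q => f (s q * α l) := rfl
  refine ⟨E, fun l f => ?_, ?_⟩
  · ext1 l'
    simp only [hE, rightShift_apply, map_mul, mul_assoc]
  · ext1 l
    rw [hE]
    by_cases hl : α l ∈ T
    · rw [if_pos hl]
      refine (congrArg e (funext fun q => ?_)).trans he₁
      simp only [d₁, T.mul_mem_cancel_right hl]
    · rw [if_neg hl]
      refine (congrArg e (funext fun q => ?_)).trans he₀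
      refine if_neg fun h => hl ?_
      exact (T.mul_mem_cancel_left (hsT q ⟨_, h, hmk q l⟩)).1 h

open Classical in
theorem exists_perm_conj_shift {K Λ : Type} [Group K] [Infinite K] [Group Λ]
    (T : Subgroup K) (α β : Λ →* K) (hα : Injective α) (hβ : Injective β)
    (hT : ∀ l, α l ∈ T ↔ β l ∈ T) {c₁ c₀ : K → Bool} (hc : c₁ ≠ c₀) :
    ∃ ρ : Equiv.Perm (K → K → Bool),
      (∀ l, ρ * rightShift K _ (α l) = rightShift K _ (β l) * ρ) ∧
      ρ (fun k => if k ∈ T then c₁ else c₀) = fun k => if k ∈ T then c₁ else c₀ := by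
  obtain ⟨E, hE, hE₀⟩ := exists_equivariant_restrict T α hα hc
  obtain ⟨F, hF, hF₀⟩ := exists_equivariant_restrict T β hβ hc
  refine ⟨E.trans F.symm, fun l => Equiv.ext fun f => F.injective ?_, F.injective ?_⟩
  · simp [hE, hF]
  · simp [hE₀, hF₀, hT]

/-- The permutation of `Y × ℤ` shifting the fibre over `y₀`. -/
def fibreShift {Y : Type*} [DecidableEq Y] (y₀ : Y) : Equiv.Perm (Y × ℤ) where
  toFun x := (x.1, if x.1 = y₀ then x.2 + 1 else x.2)
  invFun x := (x.1, if x.1 = y₀ then x.2 - 1 else x.2)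
  left_inv x := by ext <;> simp; split_ifs <;> simp
  right_inv x := by ext <;> simp; split_ifs <;> simp

/-- Permutations of `Y` acting on the first factor of `Y × ℤ`. -/
def baseAction (Y : Type*) : Equiv.Perm Y →* Equiv.Perm (Y × ℤ) where
  toFun g := g.prodCongr (Equiv.refl ℤ)
  map_one' := rfl
  map_mul' _ _ := rfl

theorem baseAction_apply {Y : Type*} (g : Equiv.Perm Y) (x : Y × ℤ) :
    baseAction Y g x = (g x.1, x.2) :=
  rfl

theorem fibreShift_apply {Y : Type*} [DecidableEq Y] (y₀ : Y) (x : Y × ℤ) :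
    fibreShift y₀ x = (x.1, if x.1 = y₀ then x.2 + 1 else x.2) :=
  rfl

theorem commute_fibreShift {Y : Type*} [DecidableEq Y] {y₀ : Y} {g : Equiv.Perm Y}
    (hg : g y₀ = y₀) : Commute (fibreShift y₀) (baseAction Y g) := by
  have h (y : Y) : g y = y₀ ↔ y = y₀ := by
    conv_lhs => rw [← hg]
    exact g.injective.eq_iff
  refine Equiv.ext fun x => ?_
  simp [fibreShift_apply, baseAction_apply, h]

theorem commutator_fibreShift_zpow {Y : Type*} [DecidableEq Y] {y₀ : Y} {g : Equiv.Perm Y}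
    (hg : g y₀ ≠ y₀) (n : ℤ)
    (hn : (fibreShift y₀ * baseAction Y g * (fibreShift y₀)⁻¹ * (baseAction Y g)⁻¹) ^ n = 1) :
    n = 0 := by
  have hg' : g⁻¹ y₀ ≠ y₀ := fun h => hg (Equiv.Perm.inv_eq_iff_eq.1 h).symm
  have step (s : ℤ) :
      (fibreShift y₀ * baseAction Y g * (fibreShift y₀)⁻¹ * (baseAction Y g)⁻¹) (y₀, s) =
        (y₀, s + 1) := by
    have h : (fibreShift y₀)⁻¹ (g⁻¹ y₀, s) = (g⁻¹ y₀, s) := by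
      rw [Equiv.Perm.inv_eq_iff_eq, fibreShift_apply, if_neg hg']
    rw [← map_inv, Equiv.Perm.mul_apply, Equiv.Perm.mul_apply, Equiv.Perm.mul_apply,
      baseAction_apply _ (y₀, s), h, baseAction_apply, fibreShift_apply]
    simp
  have key (n : ℤ) : ∀ s,
      ((fibreShift y₀ * baseAction Y g * (fibreShift y₀)⁻¹ * (baseAction Y g)⁻¹) ^ n) (y₀, s) =
        (y₀, s + n) := by
    induction n using Int.induction_on with
    | zero => simp
    | succ n ih => intro s; rw [zpow_add_one, Equiv.Perm.mul_apply, step, ih]; congr 1; ring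
    | pred n ih =>
      intro s
      rw [zpow_sub_one, Equiv.Perm.mul_apply,
        Equiv.Perm.inv_eq_iff_eq.2 ((step (s - 1)).trans (by simp)).symm, ih]
      congr 1; ring
  have := key n 0
  rw [hn] at this
  simpa using (congrArg Prod.snd this).symm

theorem exists_group_conj {K Λ I : Type} [Group K] [Infinite K] [Group Λ] (T : Subgroup K)
    (α β : I → Λ →* K) (hα : ∀ i, Injective (α i)) (hβ : ∀ i, Injective (β i))
    (hT : ∀ i l, α i l ∈ T ↔ β i l ∈ T) :
    ∃ (Γ : Type) (_ : Group Γ) (f : K →* Γ) (r : I → Γ) (k : Γ),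
      (∀ i l, r i * f (α i l) = f (β i l) * r i) ∧ (∀ i, Commute k (r i)) ∧
      (∀ t ∈ T, Commute k (f t)) ∧ ∀ t ∉ T, ∀ n : ℤ, (k * f t * k⁻¹ * (f t)⁻¹) ^ n = 1 → n = 0 := by
  classical
  have hc : (fun _ : K => true) ≠ fun _ => false := fun h => by simpa using congrFun h 1
  choose ρ hρ hρ₀ using fun i => exists_perm_conj_shift T (α i) (β i) (hα i) (hβ i) (hT i) hc
  refine ⟨_, inferInstance, (baseAction _).comp (rightShift K _), fun i => baseAction _ (ρ i),
    fibreShift fun k => if k ∈ T then fun _ : K => true else fun _ => false, fun i l => ?_,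
    fun i => commute_fibreShift (hρ₀ i), fun t ht => commute_fibreShift ?_,
    fun t ht => commutator_fibreShift_zpow ?_⟩
  · simp only [MonoidHom.comp_apply, ← map_mul, hρ]
  · ext1 k
    simp only [rightShift_apply, T.mul_mem_cancel_right ht]
  · intro h
    have := congrFun h 1
    rw [rightShift_apply, one_mul, if_neg ht, if_pos T.one_mem] at this
    exact hc this.symm

/-- The semidirect product of the functions `S × V → ZMod 2` by the translation group `V`. -/
@[ext] structure Lamp (S V : Type) where
  /-- The function part. -/
  lamp : S × V → ZMod 2
  /-- The translation part. -/
  pos : V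

namespace Lamp

variable {S V : Type} [AddCommGroup V]

instance : Mul (Lamp S V) :=
  ⟨fun a b => ⟨fun x => a.lamp x + b.lamp (x.1, x.2 - a.pos), a.pos + b.pos⟩⟩

instance : One (Lamp S V) := ⟨⟨0, 0⟩⟩

instance : Inv (Lamp S V) := ⟨fun a => ⟨fun x => -a.lamp (x.1, x.2 + a.pos), -a.pos⟩⟩

@[simp] theorem mul_lamp (a b : Lamp S V) (x : S × V) :
    (a * b).lamp x = a.lamp x + b.lamp (x.1, x.2 - a.pos) := rfl

@[simp] theorem mul_pos (a b : Lamp S V) : (a * b).pos = a.pos + b.pos := rfl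

@[simp] theorem one_lamp (x : S × V) : (1 : Lamp S V).lamp x = 0 := rfl

@[simp] theorem one_pos : (1 : Lamp S V).pos = 0 := rfl

@[simp] theorem inv_lamp (a : Lamp S V) (x : S × V) :
    a⁻¹.lamp x = -a.lamp (x.1, x.2 + a.pos) := rfl

@[simp] theorem inv_pos (a : Lamp S V) : a⁻¹.pos = -a.pos := rfl

instance : Group (Lamp S V) :=
  Group.ofLeftAxioms (fun a b c => by ext <;> simp [add_assoc, sub_sub])
    (fun a => by ext <;> simp)
    (fun a => by ext <;> simp [CharTwo.add_self_eq_zero])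

/-- The translation by `v`. -/
def trans : Multiplicative V →* Lamp S V where
  toFun v := ⟨0, v.toAdd⟩
  map_one' := rfl
  map_mul' a b := by ext <;> simp

@[simp] theorem trans_lamp (v : Multiplicative V) (x : S × V) :
    (trans v : Lamp S V).lamp x = 0 := rfl

@[simp] theorem trans_pos (v : Multiplicative V) : (trans v : Lamp S V).pos = v.toAdd := rfl

open Classical in
/-- The indicator function of a point. -/
noncomputable def point (x : S × V) : Lamp S V := ⟨Pi.single x 1, 0⟩

theorem trans_mul_point (s : S) (v c : V) :
    trans (.ofAdd c) * point (s, v) * (trans (.ofAdd c))⁻¹ = point (s, c + v) := by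
  classical
  ext x
  · simp [point, Pi.single_apply, Prod.ext_iff, sub_eq_iff_eq_add']
  · simp [point]

/-- The elements with trivial translation part and support in `H`. -/
def supported (H : Set (S × V)) : Subgroup (Lamp S V) where
  carrier := {a | a.pos = 0 ∧ ∀ x ∉ H, a.lamp x = 0}
  one_mem' := ⟨rfl, fun _ _ => rfl⟩
  mul_mem' {a b} ha hb := ⟨by simp [ha.1, hb.1], fun x hx => by
    simp [ha.1, ha.2 x hx, hb.2 x hx]⟩
  inv_mem' {a} ha := ⟨by simp [ha.1], fun x hx => by simp [ha.1, ha.2 x hx]⟩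

theorem mem_supported {H : Set (S × V)} {a : Lamp S V} :
    a ∈ supported H ↔ a.pos = 0 ∧ ∀ x ∉ H, a.lamp x = 0 := Iff.rfl

theorem point_mem_supported {H : Set (S × V)} {x : S × V} : point x ∈ supported H ↔ x ∈ H := by
  classical
  refine ⟨fun h => ?_, fun hx => ⟨rfl, fun y hy =>
    Pi.single_eq_of_ne (M := fun _ => ZMod 2) (ne_of_mem_of_not_mem hx hy).symm 1⟩⟩
  by_contra hx
  simpa [point] using h.2 x hx

/-- The embedding induced by the affine map `u ↦ (q, p + m u)`. -/
noncomputable def affine (q : S) (p : V) (m : V →+ V) (hm : Injective m) :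
    Lamp Unit V →* Lamp S V where
  toFun a := ⟨extend (fun u : Unit × V => (q, p + m u.2)) a.lamp 0, m a.pos⟩
  map_one' := by
    ext x
    · change extend _ (fun _ => (0 : ZMod 2)) (fun _ => 0) x = 0
      simp [extend]
    · simp
  map_mul' a b := by
    have hinj : Injective fun u : Unit × V => (q, p + m u.2) := fun u v h => by
      simpa [Prod.ext_iff, hm.eq_iff] using h
    ext x
    · by_cases hx : ∃ u : Unit × V, (q, p + m u.2) = x
      · obtain ⟨u, rfl⟩ := hx
        have : ((q, p + m u.2).1, (q, p + m u.2).2 - m a.pos) =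
            (fun u : Unit × V => (q, p + m u.2)) ((), u.2 - a.pos) := by
          simp [add_sub_assoc]
        simp only [mul_lamp]
        rw [this, hinj.extend_apply, hinj.extend_apply, hinj.extend_apply]
        rfl
      · have hx' : ¬ ∃ u : Unit × V, (q, p + m u.2) = (x.1, x.2 - m a.pos) := by
          rintro ⟨u, hu⟩
          refine hx ⟨((), u.2 + a.pos), ?_⟩
          simp only [Prod.ext_iff] at hu ⊢
          exact ⟨hu.1, by rw [map_add, ← add_assoc, hu.2, sub_add_cancel]⟩
        simp only [mul_lamp]
        rw [extend_apply' _ _ _ hx, extend_apply' _ _ _ hx, extend_apply' _ _ _ hx']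
        simp
    · simp

theorem affine_injective (q : S) (p : V) (m : V →+ V) (hm : Injective m) :
    Injective (affine q p m hm) := by
  have hinj : Injective fun u : Unit × V => (q, p + m u.2) := fun u v h => by
    simpa [Prod.ext_iff, hm.eq_iff] using h
  intro a b h
  ext x
  · have := congrFun (congrArg lamp h) (q, p + m x.2)
    exact (hinj.extend_apply ..).symm.trans (this.trans (hinj.extend_apply ..))
  · exact hm (congrArg pos h)

theorem affine_mem_supported (q : S) (p : V) (m : V →+ V) (hm : Injective m)
    {H : Set (S × V)} {a : Lamp Unit V} :
    affine q p m hm a ∈ supported H ↔ a.pos = 0 ∧ ∀ u, (q, p + m u) ∉ H → a.lamp ((), u) = 0 := by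
  have hinj : Injective fun u : Unit × V => (q, p + m u.2) := fun u v h => by
    simpa [Prod.ext_iff, hm.eq_iff] using h
  rw [mem_supported]
  refine and_congr (map_eq_zero_iff m hm) ⟨fun h u hu => ?_, fun h x hx => ?_⟩
  · exact (hinj.extend_apply a.lamp 0 ((), u)).symm.trans (h _ hu)
  · by_cases hx' : ∃ u : Unit × V, (q, p + m u.2) = x
    · obtain ⟨u, rfl⟩ := hx'
      exact (hinj.extend_apply a.lamp 0 u).trans (h _ hx)
    · exact extend_apply' _ _ _ hx'

theorem affine_trans (q : S) (p : V) (m : V →+ V) (hm : Injective m)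
    (v : V) :
    affine q p m hm (trans (.ofAdd v)) = trans (.ofAdd (m v)) := by
  ext x
  · change extend _ (fun _ => (0 : ZMod 2)) (fun _ => 0) x = 0
    simp [extend]
  · rfl

theorem affine_point (q : S) (p : V) (m : V →+ V) (hm : Injective m) :
    affine q p m hm (point ((), 0)) = point (q, p) := by
  classical
  have hinj : Injective fun u : Unit × V => (q, p + m u.2) := fun u v h => by
    simpa [Prod.ext_iff, hm.eq_iff] using h
  ext x
  · by_cases hx : ∃ u : Unit × V, (q, p + m u.2) = x
    · obtain ⟨u, rfl⟩ := hx
      refine (hinj.extend_apply ..).trans ?_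
      simp [point, Pi.single_apply, Prod.ext_iff, map_eq_zero_iff m hm]
    · refine (extend_apply' _ _ _ hx).trans ?_
      refine (Pi.single_eq_of_ne (M := fun _ => ZMod 2) (fun h => hx ⟨((), 0), ?_⟩) _).symm
      simpa using h.symm
  · exact map_zero m

end Lamp

/-- A machine with states `S` acting on integer registers `J → ℤ`. The instruction `i` takes the
configuration `(src i, p i + m i * u)` to `(dst i, p' i + m' i * u)`, for every `u : J → ℤ`. -/
structure AffineMachine (S J I : Type) where
  /-- The state before an instruction. -/
  src : I → S
  /-- The state after an instruction. -/
  dst : I → S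
  /-- The offset before an instruction. -/
  p : I → J → ℤ
  /-- The offset after an instruction. -/
  p' : I → J → ℤ
  /-- The multiplier before an instruction. -/
  m : I → J → ℤ
  /-- The multiplier after an instruction. -/
  m' : I → J → ℤ
  m_ne : ∀ i j, m i j ≠ 0
  m'_ne : ∀ i j, m' i j ≠ 0

/-- The product of the powers `x j ^ c j`, in a fixed order. -/
noncomputable def monomial {J G : Type} [Fintype J] [Group G] (x : J → G) (c : J → ℤ) : G :=
  ((Finset.univ : Finset J).toList.map fun j => x j ^ c j).prod

section monomial

variable {J G G' : Type} [Fintype J] [Group G] [Group G']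

theorem map_monomial (f : G →* G') (x : J → G) (c : J → ℤ) :
    f (monomial x c) = monomial (fun j => f (x j)) c := by
  simp [monomial, map_list_prod, List.map_map, comp_def]

theorem monomial_add {x : J → G} (hx : ∀ i j, Commute (x i) (x j)) (c d : J → ℤ) :
    monomial x (c + d) = monomial x c * monomial x d := by
  unfold monomial
  induction (Finset.univ : Finset J).toList with
  | nil => simp
  | cons j l ih =>
    have : Commute (x j ^ d j) (l.map fun j => x j ^ c j).prod :=
      Commute.list_prod_right _ _ fun y hy => by
        obtain ⟨i, -, rfl⟩ := List.mem_map.1 hy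
        exact (hx j i).zpow_zpow _ _
    simp only [List.map_cons, List.prod_cons, Pi.add_apply, zpow_add] at ih ⊢
    rw [ih, mul_assoc, mul_assoc, ← mul_assoc (x j ^ d j), this.eq, mul_assoc]

theorem semiconj_monomial {x : J → G} {r : G} {m m' : J → ℤ}
    (hr : ∀ j, SemiconjBy r (x j ^ m j) (x j ^ m' j)) (u : J → ℤ) :
    SemiconjBy r (monomial x (m * u)) (monomial x (m' * u)) := by
  unfold monomial
  induction (Finset.univ : Finset J).toList with
  | nil => simp
  | cons j l ih =>
    simp only [List.map_cons, List.prod_cons, Pi.mul_apply, zpow_mul] at ih ⊢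
    exact ((hr j).zpow_right _).mul_right ih

/-- The group element coding the configuration `(q, c)`. -/
noncomputable def config {S : Type} (x : J → G) (t : S → G) (q : S) (c : J → ℤ) : G :=
  monomial x c * t q * (monomial x c)⁻¹

theorem map_config {S : Type} (f : G →* G') (x : J → G) (t : S → G) (q : S) (c : J → ℤ) :
    f (config x t q c) = config (fun j => f (x j)) (fun q => f (t q)) q c := by
  simp [config, map_monomial]

end monomial

namespace AffineMachine

variable {S J I : Type} (M : AffineMachine S J I)

/-- The step relation of an affine machine. -/
def Step (a b : S × (J → ℤ)) : Prop :=
  ∃ i u, a = (M.src i, M.p i + M.m i * u) ∧ b = (M.dst i, M.p' i + M.m' i * u)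

/-- The defining relations of the group simulating an affine machine with a final
configuration. -/
structure Realization [Fintype J] (fin : S × (J → ℤ)) {G : Type} [Group G] (x : J → G) (t : S → G)
    (r : I → G) (k : G) : Prop where
  comm : ∀ i j, x i * x j = x j * x i
  conj : ∀ i j, r i * x j ^ M.m i j = x j ^ M.m' i j * r i
  conf : ∀ i, r i * config x t (M.src i) (M.p i) = config x t (M.dst i) (M.p' i) * r i
  comm_r : ∀ i, k * r i = r i * k
  comm_fin : k * config x t fin.1 fin.2 = config x t fin.1 fin.2 * k

variable {M} [Fintype J] {fin : S × (J → ℤ)}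

theorem Realization.commute_of_step {G : Type} [Group G] {x : J → G} {t : S → G} {r : I → G}
    {k : G} (h : M.Realization fin x t r k) {a b : S × (J → ℤ)} (hab : M.Step a b)
    (hb : Commute k (config x t b.1 b.2)) : Commute k (config x t a.1 a.2) := by
  obtain ⟨i, u, rfl, rfl⟩ := hab
  have hm : SemiconjBy (r i) (monomial x (M.m i * u)) (monomial x (M.m' i * u)) :=
    semiconj_monomial (h.conj i) u
  have key : SemiconjBy (r i) (config x t (M.src i) (M.p i + M.m i * u))
      (config x t (M.dst i) (M.p' i + M.m' i * u)) := by
    have hc (q : S) (c d : J → ℤ) : config x t q (c + d) =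
        monomial x d * config x t q c * (monomial x d)⁻¹ := by
      rw [add_comm, config, monomial_add h.comm, config]
      group
    rw [hc, hc]
    exact (hm.mul_right (h.conf i)).mul_right hm.inv_right
  have hkr : Commute k (r i) := h.comm_r i
  have : config x t (M.src i) (M.p i + M.m i * u) =
      (r i)⁻¹ * config x t (M.dst i) (M.p' i + M.m' i * u) * r i := by
    rw [mul_assoc, ← key.eq, inv_mul_cancel_left]
  rw [this]
  exact (hkr.inv_right.mul_right hb).mul_right hkr

theorem Realization.commute_of_reaches {G : Type} [Group G] {x : J → G} {t : S → G} {r : I → G}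
    {k : G} (h : M.Realization fin x t r k) {a : S × (J → ℤ)}
    (ha : Relation.ReflTransGen M.Step a fin) : Commute k (config x t a.1 a.2) := by
  induction ha using Relation.ReflTransGen.head_induction_on with
  | refl => exact h.comm_fin
  | head hab _ ih => exact h.commute_of_step hab ih

theorem exists_realization [Nonempty J] (H : Set (S × (J → ℤ))) (hfin : fin ∈ H)
    (hH : ∀ a b, M.Step a b → (a ∈ H ↔ b ∈ H)) :
    ∃ (G : Type) (_ : Group G) (x : J → G) (t : S → G) (r : I → G) (k : G),
      M.Realization fin x t r k ∧ ∀ a ∉ H, ∀ n : ℤ,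
        (k * config x t a.1 a.2 * k⁻¹ * (config x t a.1 a.2)⁻¹) ^ n = 1 → n = 0 := by
  classical
  have hinj (m : J → ℤ) (hm : ∀ j, m j ≠ 0) : Injective (AddMonoidHom.mulLeft m) := by
    intro a b h
    ext j
    exact mul_left_cancel₀ (hm j) (congrFun h j)
  have : Infinite (Lamp S (J → ℤ)) :=
    Infinite.of_surjective (Lamp.pos) fun v => ⟨Lamp.trans (.ofAdd v), rfl⟩
  obtain ⟨G, _, f, r, k, h₁, h₂, h₃, h₄⟩ := exists_group_conj (Lamp.supported H)
    (fun i => Lamp.affine (M.src i) (M.p i) (.mulLeft (M.m i)) (hinj _ (M.m_ne i)))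
    (fun i => Lamp.affine (M.dst i) (M.p' i) (.mulLeft (M.m' i)) (hinj _ (M.m'_ne i)))
    (fun i => Lamp.affine_injective ..) (fun i => Lamp.affine_injective ..) fun i l => by
      rw [Lamp.affine_mem_supported, Lamp.affine_mem_supported]
      exact and_congr_right fun _ => forall_congr' fun u =>
        imp_congr_left (not_congr (hH _ _ ⟨i, u, rfl, rfl⟩))
  let x : J → Lamp S (J → ℤ) := fun j => Lamp.trans (.ofAdd (Pi.single j 1))
  let t : S → Lamp S (J → ℤ) := fun q => Lamp.point (q, 0)
  have hmon (c : J → ℤ) : monomial x c = Lamp.trans (.ofAdd c) := by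
    rw [show x = fun j => Lamp.trans (Multiplicative.ofAdd (Pi.single j (1 : ℤ))) from rfl,
      ← map_monomial, monomial, Finset.prod_map_toList]
    congr 1
    refine Multiplicative.toAdd.injective ?_
    rw [toAdd_prod]
    ext j
    simp [Finset.sum_apply, Pi.single_apply]
  have hconf (q : S) (c : J → ℤ) : config x t q c = Lamp.point (q, c) := by
    rw [config, hmon, Lamp.trans_mul_point, add_zero]
  have hconf' (q : S) (c : J → ℤ) :
      config (fun j => f (x j)) (fun q => f (t q)) q c = f (Lamp.point (q, c)) := by
    rw [← map_config, hconf]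
  refine ⟨G, inferInstance, fun j => f (x j), fun q => f (t q), r, k,
    ⟨fun i j => ?_, fun i j => ?_, fun i => ?_, h₂, ?_⟩, fun a ha => ?_⟩
  · rw [← map_mul f, ← map_mul f]
    exact congrArg f (((Commute.all _ _).map Lamp.trans).eq)
  · have h (m : J → ℤ) : x j ^ m j = Lamp.trans (.ofAdd (m * Pi.single j 1)) := by
      rw [← map_zpow (Lamp.trans (S := S) (V := J → ℤ)), ← ofAdd_zsmul]
      congr 2
      ext i
      by_cases hi : i = j
      · subst hi; simp
      · simp [hi]
    have := h₁ i (Lamp.trans (.ofAdd (Pi.single j 1)))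
    rw [Lamp.affine_trans, Lamp.affine_trans] at this
    rw [← map_zpow f, ← map_zpow f, h, h]
    exact this
  · have := h₁ i (Lamp.point ((), 0))
    rw [Lamp.affine_point, Lamp.affine_point] at this
    rwa [hconf', hconf']
  · rw [hconf']
    exact h₃ _ (Lamp.point_mem_supported.2 hfin)
  · rw [hconf']
    exact h₄ _ (mt Lamp.point_mem_supported.1 ha)

end AffineMachine

open Turing PartrecToTM2

namespace AffineMachine

variable {S J I : Type} (M : AffineMachine S J I)

/-- The restriction of an affine machine to a closed set of states. -/
def restrict (P : Set S) (hP : ∀ i, M.src i ∈ P → M.dst i ∈ P) :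
    AffineMachine P J {i // M.src i ∈ P} where
  src i := ⟨M.src i, i.2⟩
  dst i := ⟨M.dst i, hP i i.2⟩
  p i := M.p i
  p' i := M.p' i
  m i := M.m i
  m' i := M.m' i
  m_ne i := M.m_ne i
  m'_ne i := M.m'_ne i

theorem restrict_step_iff {P : Set S} {hP : ∀ i, M.src i ∈ P → M.dst i ∈ P} {a b : P × (J → ℤ)} :
    (M.restrict P hP).Step a b ↔ M.Step (a.1.1, a.2) (b.1.1, b.2) := by
  obtain ⟨⟨a, ha⟩, c⟩ := a
  obtain ⟨⟨b, hb⟩, d⟩ := b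
  constructor
  · rintro ⟨i, u, h₁, h₂⟩
    simp only [restrict, Prod.mk.injEq, Subtype.mk.injEq] at h₁ h₂
    exact ⟨i, u, by simp [h₁], by simp [h₂]⟩
  · rintro ⟨i, u, h₁, h₂⟩
    simp only [Prod.mk.injEq] at h₁ h₂
    obtain ⟨rfl, rfl⟩ := h₁
    obtain ⟨rfl, rfl⟩ := h₂
    exact ⟨⟨i, ha⟩, u, rfl, rfl⟩

theorem restrict_reaches_iff {P : Set S} {hP : ∀ i, M.src i ∈ P → M.dst i ∈ P}
    {a b : P × (J → ℤ)} : Relation.ReflTransGen (M.restrict P hP).Step a b ↔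
      Relation.ReflTransGen M.Step (a.1.1, a.2) (b.1.1, b.2) := by
  refine ⟨fun h => h.lift (fun x : P × (J → ℤ) => (x.1.1, x.2)) fun _ _ =>
    M.restrict_step_iff.1, fun h => ?_⟩
  suffices ∀ x, Relation.ReflTransGen M.Step x (b.1.1, b.2) → ∀ hx : x.1 ∈ P,
      Relation.ReflTransGen (M.restrict P hP).Step (⟨x.1, hx⟩, x.2) b from this _ h a.1.2
  intro x h
  induction h using Relation.ReflTransGen.head_induction_on with
  | refl => exact fun _ => .refl
  | @head x y hxy _ ih =>
    intro hx
    have hy : y.1 ∈ P := by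
      obtain ⟨i, u, rfl, rfl⟩ := hxy
      exact hP i hx
    exact .head (M.restrict_step_iff.2 hxy) (ih hy)

end AffineMachine

/-- The base-five digit of the top symbol of a stack. -/
def digit : Option Γ' → ℕ
  | none => 0
  | some .consₗ => 1
  | some .cons => 2
  | some .bit0 => 3
  | some .bit1 => 4

theorem digit_lt (d : Option Γ') : digit d < 5 := by
  rcases d with _ | _ | _ | _ | _ <;> simp [digit]

theorem digit_injective : Injective digit := by
  rintro (_ | _ | _ | _ | _) (_ | _ | _ | _ | _) h <;> simp_all [digit]

/-- The base-five code of a stack. -/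
def stackCode : List Γ' → ℕ
  | [] => 0
  | g :: l => digit (some g) + 5 * stackCode l

theorem stackCode_eq (l : List Γ') :
    stackCode l = digit l.head? + 5 * stackCode l.tail := by
  cases l <;> simp [stackCode, digit]

/-- The multiplier corresponding to a change of the stack `k`. -/
def scale (k : K') : K' → ℤ := fun j => if j = k then 5 else 1

theorem scale_ne_zero (k j : K') : scale k j ≠ 0 := by
  unfold scale
  split_ifs <;> simp

/-- The effect of an instruction of `Turing.PartrecToTM2.tr`, by the next statement, the next local
store, the stack that is used, and its new contents. -/
noncomputable def stackMachine :
    AffineMachine (Option Stmt' × Option Γ') K' (Stmt' × Option Γ' × Option Γ') where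
  src i := (some i.1, i.2.1)
  dst
    | (.push _ _ q, v, _) => (some q, v)
    | (.peek _ f q, v, d) => (some q, f v d)
    | (.pop _ f q, v, d) => (some q, f v d)
    | (.load f q, v, _) => (some q, f v)
    | (.branch f q₁ q₂, v, _) => (some (cond (f v) q₁ q₂), v)
    | (.goto f, v, _) => (some (tr (f v)), v)
    | (.halt, v, _) => (none, v)
  p
    | (.peek k _ _, _, d) => Pi.single k (digit d)
    | (.pop k _ _, _, d) => Pi.single k (digit d)
    | _ => 0
  p'
    | (.push k f _, v, _) => Pi.single k (digit (some (f v)))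
    | (.peek k _ _, _, d) => Pi.single k (digit d)
    | _ => 0
  m
    | (.peek k _ _, _, _) => scale k
    | (.pop k _ _, _, _) => scale k
    | _ => 1
  m'
    | (.push k _ _, _, _) => scale k
    | (.peek k _ _, _, _) => scale k
    | _ => 1
  m_ne i j := by
    rcases i with ⟨_ | _ | _ | _ | _ | _ | _, v, d⟩ <;> simp [scale_ne_zero]
  m'_ne i j := by
    rcases i with ⟨_ | _ | _ | _ | _ | _ | _, v, d⟩ <;> simp [scale_ne_zero]

theorem single_add_update_injective {k : K'} {d d' : Option Γ'} {u u' : K' → ℤ}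
    (h : (Pi.single k (digit d : ℤ) : K' → ℤ) + scale k * u =
      Pi.single k (digit d' : ℤ) + scale k * u') : d = d' ∧ u = u' := by
  have hk := congrFun h k
  have h₁ := digit_lt d
  have h₂ := digit_lt d'
  simp only [Pi.add_apply, Pi.mul_apply, Pi.single_eq_same, scale, if_true] at hk
  refine ⟨digit_injective (by omega), funext fun j => ?_⟩
  by_cases hj : j = k
  · subst hj; omega
  · simpa [hj, scale] using congrFun h j

theorem stackMachine_step_unique {a b b' : (Option Stmt' × Option Γ') × (K' → ℤ)}
    (h : stackMachine.Step a b) (h' : stackMachine.Step a b') : b = b' := by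
  obtain ⟨⟨q, v, d⟩, u, rfl, rfl⟩ := h
  obtain ⟨⟨q', v', d'⟩, u', h, rfl⟩ := h'
  simp only [Prod.mk.injEq] at h
  obtain ⟨h₁, h₂⟩ := h
  simp only [stackMachine, Prod.mk.injEq, Option.some.injEq] at h₁
  obtain ⟨rfl, rfl⟩ := h₁
  rcases q with _ | _ | _ | _ | _ | _ | _
  case peek | pop => obtain ⟨rfl, rfl⟩ := single_add_update_injective h₂; rfl
  all_goals
    have : u = u' := by simpa [stackMachine] using h₂
    subst this; rfl

/-- The configuration of `stackMachine` coding a configuration of `Turing.PartrecToTM2.tr`. -/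
def encodeCfg (c : Cfg') : (Option Stmt' × Option Γ') × (K' → ℤ) :=
  ((c.l.map tr, c.var), fun k => stackCode (c.stk k))

theorem stackCode_pop (T : K' → List Γ') (k : K') : (fun j => (stackCode (T j) : ℤ)) =
    Pi.single k (digit (T k).head? : ℤ) +
      scale k * fun j => (stackCode (update T k (T k).tail j) : ℤ) := by
  ext j
  by_cases hj : j = k
  · subst hj
    conv_lhs => rw [stackCode_eq]
    simp [scale]
  · simp [hj, scale]

theorem stackMachine_transGen_stepAux (q : Stmt') (v : Option Γ') (T : K' → List Γ') :
    Relation.TransGen stackMachine.Step ((some q, v), fun k => (stackCode (T k) : ℤ))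
      (encodeCfg (TM2.stepAux q v T)) := by
  have hid (u : K' → ℤ) : u = 0 + 1 * u := by simp
  induction q generalizing v T with
  | push k f q ih =>
    refine .head ?_ (ih v (update T k (f v :: T k)))
    refine ⟨(.push k f q, v, none), _, Prod.ext rfl (hid _), Prod.ext rfl ?_⟩
    refine (stackCode_pop _ k).trans ?_
    simp [stackMachine]
  | peek k f q ih =>
    refine .head ?_ (ih (f v (T k).head?) T)
    exact ⟨(.peek k f q, v, (T k).head?), _, Prod.ext rfl (stackCode_pop T k),
      Prod.ext rfl (stackCode_pop T k)⟩
  | pop k f q ih =>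
    refine .head ?_ (ih (f v (T k).head?) (update T k (T k).tail))
    exact ⟨(.pop k f q, v, (T k).head?), _, Prod.ext rfl (stackCode_pop T k),
      Prod.ext rfl (hid _)⟩
  | load f q ih =>
    refine .head ?_ (ih (f v) T)
    exact ⟨(.load f q, v, none), _, Prod.ext rfl (hid _), Prod.ext rfl (hid _)⟩
  | branch f q₁ q₂ ih₁ ih₂ =>
    refine .head (b := ((some (cond (f v) q₁ q₂), v), fun k => (stackCode (T k) : ℤ)))
      ⟨(.branch f q₁ q₂, v, none), _, Prod.ext rfl (hid _), Prod.ext rfl (hid _)⟩ ?_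
    rw [TM2.stepAux]
    cases f v
    · exact ih₂ v T
    · exact ih₁ v T
  | goto f => exact .single ⟨(.goto f, v, none), _, Prod.ext rfl (hid _), Prod.ext rfl (hid _)⟩
  | halt => exact .single ⟨(.halt, v, none), _, Prod.ext rfl (hid _), Prod.ext rfl (hid _)⟩

theorem encodeCfg_halt_not_step (v : List ℕ) (b) : ¬ stackMachine.Step (encodeCfg (halt v)) b := by
  rintro ⟨i, u, h, -⟩
  have := congrArg (fun x => x.1.1) h
  simp [encodeCfg, halt, stackMachine] at this

open Classical in
theorem stackMachine_reaches_halt_iff (c : ToPartrec.Code) (v w : List ℕ) :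
    Relation.ReflTransGen stackMachine.Step (encodeCfg (init c v)) (encodeCfg (halt w)) ↔
      ∃ w' ∈ c.eval v, encodeCfg (halt w') = encodeCfg (halt w) := by
  let f : (Option Stmt' × Option Γ') × (K' → ℤ) → Option ((Option Stmt' × Option Γ') × (K' → ℤ)) :=
    fun a => if h : ∃ b, stackMachine.Step a b then some h.choose else none
  have hf (a b) : b ∈ f a ↔ stackMachine.Step a b := by
    by_cases h : ∃ b, stackMachine.Step a b
    · simp only [f, dif_pos h, Option.mem_def, Option.some.injEq]
      refine ⟨fun hb => hb ▸ h.choose_spec, stackMachine_step_unique h.choose_spec⟩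
    · simp only [f, dif_neg h, Option.mem_def, reduceCtorEq, false_iff]
      exact fun hb => h ⟨b, hb⟩
  have hrel : (fun a b => b ∈ f a) = stackMachine.Step := by ext a b; exact hf a b
  have hfn (a) : f a = none ↔ ∀ b, ¬ stackMachine.Step a b := by
    simp only [Option.eq_none_iff_forall_not_mem, hf]
  have hresp : StateTransition.Respects (TM2.step tr) f fun a b => encodeCfg a = b := by
    refine StateTransition.fun_respects.2 ?_
    rintro ⟨_ | l, x, T⟩
    · refine (hfn _).2 fun b => ?_
      rintro ⟨i, u, h, -⟩
      have := congrArg (fun x => x.1.1) h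
      simp [encodeCfg, stackMachine] at this
    · have := stackMachine_transGen_stepAux (tr l) x T
      rw [← hrel] at this
      exact this
  have h := StateTransition.tr_eval' _ _ _ hresp (init c v)
  rw [PartrecToTM2.tr_eval] at h
  have h' : encodeCfg (halt w) ∈ StateTransition.eval f (encodeCfg (init c v)) ↔
      Relation.ReflTransGen stackMachine.Step (encodeCfg (init c v)) (encodeCfg (halt w)) := by
    rw [StateTransition.mem_eval, hfn]
    simp only [StateTransition.Reaches, hrel, and_iff_left_iff_imp]
    exact fun _ => encodeCfg_halt_not_step w
  rw [← h', h]
  constructor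
  · intro hw
    obtain ⟨a, ha, e⟩ := (Part.mem_map_iff _).1 hw
    obtain ⟨w', hw', rfl⟩ := (Part.mem_map_iff _).1 ha
    exact ⟨w', hw', e⟩
  · rintro ⟨w', hw', e⟩
    exact (Part.mem_map_iff _).2 ⟨_, (Part.mem_map_iff _).2 ⟨w', hw', rfl⟩, e⟩

theorem stackMachine_dst_mem_stmts (c : ToPartrec.Code) (i : Stmt' × Option Γ' × Option Γ')
    (hi : (stackMachine.src i).1 ∈ TM2.stmts tr (codeSupp c Cont'.halt)) :
    (stackMachine.dst i).1 ∈ TM2.stmts tr (codeSupp c Cont'.halt) := by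
  classical
  obtain ⟨q, v, d⟩ := i
  cases q with
  | push | peek | pop | load =>
    exact TM2.stmts_trans (by simp [TM2.stmts₁, TM2.stmts₁_self]) hi
  | branch f q₁ q₂ =>
    refine TM2.stmts_trans ?_ hi
    change (bif f v then q₁ else q₂) ∈ insert _ (TM2.stmts₁ q₁ ∪ TM2.stmts₁ q₂)
    cases f v
    · exact Finset.mem_insert_of_mem (Finset.mem_union_right _ TM2.stmts₁_self)
    · exact Finset.mem_insert_of_mem (Finset.mem_union_left _ TM2.stmts₁_self)
  | goto f =>
    have h := @TM2.stmts_supportsStmt _ _ _ _ ⟨_⟩ _ _ _ (tr_supports c Cont'.halt) hi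
    refine Finset.some_mem_insertNone.2 (Finset.mem_biUnion.2 ⟨f v, h v, TM2.stmts₁_self⟩)
  | halt => exact Finset.none_mem_insertNone

theorem exists_machine_of_code (c : ToPartrec.Code) (hc : ∀ n, ∀ w ∈ c.eval [n], w = [0]) :
    ∃ (S I : Type) (_ : Finite S) (_ : Finite I) (M : AffineMachine S K' I) (fin : S × (K' → ℤ))
      (q₀ : S), (∀ a b b', M.Step a b → M.Step a b' → b = b') ∧ (∀ b, ¬ M.Step fin b) ∧
      ∀ n : ℕ, Relation.ReflTransGen M.Step
        (q₀, Pi.single .main (stackCode (trList [n]) : ℤ)) fin ↔ (c.eval [n]).Dom := by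
  let P : Set (Option Stmt' × Option Γ') := {s | s.1 ∈ TM2.stmts tr (codeSupp c Cont'.halt)}
  have hfin : P.Finite := by
    refine ((TM2.stmts tr (codeSupp c Cont'.halt)).finite_toSet.prod Set.finite_univ).subset
      fun s hs => ⟨hs, trivial⟩
  have : Finite P := hfin
  have : Finite {i // stackMachine.src i ∈ P} := by
    refine Finite.of_injective (β := P × Option Γ') (fun i => (⟨_, i.2⟩, i.1.2.2)) ?_
    rintro ⟨⟨q, v, d⟩, h⟩ ⟨⟨q', v', d'⟩, h'⟩ hh
    obtain ⟨⟨rfl, rfl⟩, rfl⟩ : (q = q' ∧ v = v') ∧ d = d' := by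
      simpa [stackMachine] using hh
    rfl
  have h₁ : (some (tr (trNormal c Cont'.halt)), none) ∈ P := by
    classical
    exact Finset.some_mem_insertNone.2 (Finset.mem_biUnion.2
      ⟨_, (tr_supports c Cont'.halt).1, TM2.stmts₁_self⟩)
  refine ⟨P, _, inferInstance, inferInstance,
    stackMachine.restrict P fun i => stackMachine_dst_mem_stmts c i,
    (⟨(encodeCfg (halt [0])).1, Finset.none_mem_insertNone⟩, (encodeCfg (halt [0])).2),
    ⟨_, h₁⟩, fun a b b' h h' => ?_, fun b h => ?_, fun n => ?_⟩
  · have := stackMachine_step_unique (stackMachine.restrict_step_iff.1 h)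
      (stackMachine.restrict_step_iff.1 h')
    simpa [Prod.ext_iff, Subtype.ext_iff] using this
  · exact encodeCfg_halt_not_step _ _ (stackMachine.restrict_step_iff.1 h)
  · rw [AffineMachine.restrict_reaches_iff]
    have hinit : encodeCfg (init c [n]) = ((some (tr (trNormal c Cont'.halt)), none),
        Pi.single K'.main (stackCode (trList [n]) : ℤ)) := by
      refine Prod.ext rfl (funext fun k => ?_)
      cases k <;> simp [encodeCfg, init, stackCode]
    have := stackMachine_reaches_halt_iff c [n] [0]
    rw [hinit] at this
    refine this.trans ⟨fun ⟨w, hw, _⟩ => Part.dom_iff_mem.2 ⟨w, hw⟩, fun h => ?_⟩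
    obtain ⟨w, hw⟩ := Part.dom_iff_mem.1 h
    exact ⟨w, hw, by rw [hc n w hw]⟩

theorem monomial_single {J G : Type} [Fintype J] [DecidableEq J] [Group G] (x : J → G) (j : J)
    (n : ℕ) : monomial x (Pi.single j (n : ℤ)) = x j ^ n := by
  rw [monomial, List.prod_map_eq_pow_single j _ fun i hi _ => by simp [hi],
    List.count_eq_one_of_mem (Finset.nodup_toList _) (by simp)]
  simp

theorem AffineMachine.exists_relators {S J I : Type} [Finite S] [Fintype J] [Finite I]
    (M : AffineMachine S J I) (fin : S × (J → ℤ)) :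
    ∃ R : Set (FreeGroup (J ⊕ S ⊕ I ⊕ Bool)), R.Finite ∧
      ∀ (G : Type) [Group G] (f : J ⊕ S ⊕ I ⊕ Bool → G), (∀ r ∈ R, FreeGroup.lift f r = 1) ↔
        M.Realization fin (f ∘ .inl) (f ∘ .inr ∘ .inl) (f ∘ .inr ∘ .inr ∘ .inl)
          (f (.inr (.inr (.inr true)))) := by
  let x : J → FreeGroup (J ⊕ S ⊕ I ⊕ Bool) := fun j => .of (.inl j)
  let t : S → FreeGroup (J ⊕ S ⊕ I ⊕ Bool) := fun q => .of (.inr (.inl q))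
  let r : I → FreeGroup (J ⊕ S ⊕ I ⊕ Bool) := fun i => .of (.inr (.inr (.inl i)))
  let k : FreeGroup (J ⊕ S ⊕ I ⊕ Bool) := .of (.inr (.inr (.inr true)))
  let lhs : (J × J) ⊕ (I × J) ⊕ I ⊕ I ⊕ Unit → FreeGroup (J ⊕ S ⊕ I ⊕ Bool) :=
    Sum.elim (fun p => x p.1 * x p.2) <| Sum.elim (fun p => r p.1 * x p.2 ^ M.m p.1 p.2) <|
      Sum.elim (fun i => r i * config x t (M.src i) (M.p i)) <| Sum.elim (fun i => k * r i) <|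
      fun _ => k * config x t fin.1 fin.2
  let rhs : (J × J) ⊕ (I × J) ⊕ I ⊕ I ⊕ Unit → FreeGroup (J ⊕ S ⊕ I ⊕ Bool) :=
    Sum.elim (fun p => x p.2 * x p.1) <| Sum.elim (fun p => x p.2 ^ M.m' p.1 p.2 * r p.1) <|
      Sum.elim (fun i => config x t (M.dst i) (M.p' i) * r i) <| Sum.elim (fun i => r i * k) <|
      fun _ => config x t fin.1 fin.2 * k
  refine ⟨Set.range fun i => lhs i * (rhs i)⁻¹, Set.finite_range _, fun G _ f => ?_⟩
  have hx : FreeGroup.lift f ∘ x = f ∘ .inl := funext fun j => FreeGroup.lift_apply_of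
  have ht : FreeGroup.lift f ∘ t = f ∘ .inr ∘ .inl := funext fun j => FreeGroup.lift_apply_of
  have hc (q : S) (c : J → ℤ) : FreeGroup.lift f (config x t q c) =
      config (f ∘ .inl) (f ∘ .inr ∘ .inl) q c := by
    rw [map_config, ← hx, ← ht]
    rfl
  simp only [Set.forall_mem_range, map_mul, map_inv, mul_inv_eq_one, Sum.forall, lhs, rhs,
    Sum.elim_inl, Sum.elim_inr, Prod.forall, hc, map_zpow]
  simp only [x, r, k, FreeGroup.lift_apply_of]
  exact ⟨fun ⟨h₁, h₂, h₃, h₄, h₅⟩ => ⟨h₁, h₂, h₃, h₄, h₅ ()⟩,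
    fun ⟨h₁, h₂, h₃, h₄, h₅⟩ => ⟨h₁, h₂, h₃, h₄, fun _ => h₅⟩⟩

/-- The halting problem for a code reduces to the word problem for `w` over finitely many relators,
given the additional relator `z = x ^ stackCode (trList [n])`. -/
theorem exists_relators_of_code (c : ToPartrec.Code) (hc : ∀ n, ∀ w ∈ c.eval [n], w = [0]) :
    ∃ (ι : Type) (_ : Finite ι) (R : Set (FreeGroup ι)) (z x : ι) (w : FreeGroup ι), R.Finite ∧
      ∀ n : ℕ,
        ((c.eval [n]).Dom → ∀ (G : Type) [Group G] (f : ι → G),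
          (∀ r ∈ R, FreeGroup.lift f r = 1) → f z = f x ^ stackCode (trList [n]) →
            FreeGroup.lift f w = 1) ∧
        (¬ (c.eval [n]).Dom → ∃ (G : Type) (_ : Group G) (f : ι → G),
          (∀ r ∈ R, FreeGroup.lift f r = 1) ∧ f z = f x ^ stackCode (trList [n]) ∧
            ∀ m : ℤ, FreeGroup.lift f w ^ m = 1 → m = 0) := by
  classical
  obtain ⟨S, I, _, _, M, fin, q₀, huniq, hterm, hM⟩ := exists_machine_of_code c hc
  let _ : Fintype K' := ⟨{.main, .rev, .aux, .stack}, by rintro (_ | _ | _ | _) <;> simp⟩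
  have : Nonempty K' := ⟨.main⟩
  have hcfg {G : Type} [Group G] (x : K' → G) (t : S → G)
      (n : ℕ) : config x t q₀ (Pi.single .main (n : ℤ)) =
        x .main ^ n * t q₀ * (x .main ^ n)⁻¹ := by
    rw [config, ← monomial_single]
  obtain ⟨R, hR, h⟩ := M.exists_relators fin
  let k : FreeGroup (K' ⊕ S ⊕ I ⊕ Bool) := .of (.inr (.inr (.inr true)))
  let y : FreeGroup (K' ⊕ S ⊕ I ⊕ Bool) := .of (.inr (.inr (.inr false))) * .of (.inr (.inl q₀)) *
    (.of (.inr (.inr (.inr false))))⁻¹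
  refine ⟨_, inferInstance, R, .inr (.inr (.inr false)), .inl .main, k * y * k⁻¹ * y⁻¹, hR,
    fun n => ⟨fun hn G _ f hf hz => ?_, fun hn => ?_⟩⟩
  · have hr := (h G f).1 hf
    have := hr.commute_of_reaches ((hM n).2 hn)
    simp only [hcfg] at this
    simp only [k, y, map_mul, map_inv, FreeGroup.lift_apply_of, hz]
    rw [mul_inv_eq_one, mul_inv_eq_iff_eq_mul]
    exact this
  · obtain ⟨G, _, x, t, r, k', hr, hk⟩ := M.exists_realization (fin := fin)
      {a | Relation.ReflTransGen M.Step a fin} .refl fun a b hab => by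
        refine ⟨fun ha => ?_, fun hb => .head hab hb⟩
        rcases Relation.ReflTransGen.cases_head ha with rfl | ⟨b', hb', h'⟩
        · exact (hterm _ hab).elim
        · exact huniq _ _ _ hb' hab ▸ h'
    refine ⟨G, _, Sum.elim x <| Sum.elim t <| Sum.elim r fun b =>
      bif b then k' else x .main ^ stackCode (trList [n]), (h G _).2 hr, rfl, fun m hm => ?_⟩
    refine hk (q₀, Pi.single .main (stackCode (trList [n]) : ℤ)) (mt (hM n).1 hn) m ?_
    simpa only [hcfg, k, y, map_mul, map_inv, FreeGroup.lift_apply_of, Sum.elim_inl,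
      Sum.elim_inr, cond_true, cond_false] using hm

/-- Finitely many further relators force the group to be trivial when `w = 1`, but are consistent
with any group in which `w` has infinite order. -/
theorem exists_rabin_relators {ι : Type} [Finite ι] {R : Set (FreeGroup ι)} (hR : R.Finite)
    (w : FreeGroup ι) :
    ∃ R' : Set (FreeGroup (Option ι ⊕ Option ι)), R'.Finite ∧
      (∀ (G : Type) [Group G] (f : Option ι ⊕ Option ι → G), (∀ r ∈ R', FreeGroup.lift f r = 1) →
        (∀ r ∈ R, FreeGroup.lift (f ∘ .inl ∘ some) r = 1) ∧
          (FreeGroup.lift (f ∘ .inl ∘ some) w = 1 → ∀ i, f i = 1)) ∧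
      ∀ (G : Type) [Group G] (f : ι → G), (∀ r ∈ R, FreeGroup.lift f r = 1) →
        (∀ m : ℤ, FreeGroup.lift f w ^ m = 1 → m = 0) →
        ∃ (G' : Type) (_ : Group G') (φ : G →* G') (f' : Option ι ⊕ Option ι → G'),
          (∀ r ∈ R', FreeGroup.lift f' r = 1) ∧ f' ∘ .inl ∘ some = φ ∘ f ∧ ∃ i, f' i ≠ 1 := by
  have := Fintype.ofFinite ι
  let a : FreeGroup (Option ι ⊕ Option ι) := .of (.inl none)
  let u : Option ι → FreeGroup (Option ι ⊕ Option ι) :=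
    fun y => y.elim 1 (fun i => .of (.inl (some i))) * a
  let s : Option ι → FreeGroup (Option ι ⊕ Option ι) := fun y => .of (.inr y)
  let v : FreeGroup (Option ι ⊕ Option ι) := FreeGroup.map (.inl ∘ some) w
  have hmap {G : Type} [Group G] (f : Option ι ⊕ Option ι → G) (r : FreeGroup ι) :
      FreeGroup.lift f (FreeGroup.map (.inl ∘ some) r) = FreeGroup.lift (f ∘ .inl ∘ some) r := by
    rw [← MonoidHom.comp_apply]
    congr 1
    ext i
    simp
  have hu {G : Type} [Group G] (f : Option ι ⊕ Option ι → G) (y : Option ι) :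
      FreeGroup.lift f (u y) = y.elim 1 (fun i => f (.inl (some i))) * f (.inl none) := by
    cases y <;> simp [u, a]
  refine ⟨FreeGroup.map (.inl ∘ some) '' R ∪
    (Set.range (fun y => (s y)⁻¹ * u y * s y * (u y ^ 2)⁻¹) ∪
    Set.range fun y => v⁻¹ * s y * v * (s y ^ 2)⁻¹), (hR.image _).union
      ((Set.finite_range _).union (Set.finite_range _)), fun G _ f hf => ?_, fun G _ f hf hw => ?_⟩
  · simp only [Set.mem_union, or_imp, forall_and, Set.forall_mem_image, Set.forall_mem_range, hmap,
      map_mul, map_inv, map_pow, mul_inv_eq_one, hu, v, s, FreeGroup.lift_apply_of] at hf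
    obtain ⟨h₁, h₂, h₃⟩ := hf
    refine ⟨fun r hr => h₁ hr, fun hw => ?_⟩
    have hs (y) : f (.inr y) = 1 := by simpa [hw, sq] using h₃ y
    have hy (y : Option ι) : y.elim 1 (fun i => f (.inl (some i))) * f (.inl none) = 1 := by
      simpa [hs, sq] using h₂ y
    have ha : f (.inl none) = 1 := by simpa using hy none
    rintro ((_ | i) | y)
    · exact ha
    · simpa [ha] using hy (some i)
    · exact hs y
  · obtain ⟨U, _, φ, b, hφ, hψ⟩ := exists_free_letter _ hw
    choose ψ hψ₁ hψ₂ hψ₃ using hψ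
    obtain ⟨U', _, θ, σ, hθ, hσ⟩ := exists_overgroup_conj_sq_finset
      (Finset.univ : Finset (Option ι)) (fun y => ψ (y.elim 1 f)) fun y => hψ₁ _
    let f' : Option ι ⊕ Option ι → U' := Sum.elim (fun y => y.elim (θ b) fun i => θ (φ (f i))) σ
    have hf' : f' ∘ .inl ∘ some = (θ.comp φ) ∘ f := rfl
    have hlift (r) : FreeGroup.lift (f' ∘ .inl ∘ some) r = θ (φ (FreeGroup.lift f r)) := by
      rw [hf']
      change _ = ((θ.comp φ).comp (FreeGroup.lift f)) r
      congr 1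
      ext i
      simp
    have hu' (y : Option ι) : y.elim 1 (fun i => f' (.inl (some i))) * f' (.inl none) =
        θ (φ (y.elim 1 f) * b) := by
      cases y <;> simp [f']
    have hσ' (y : Option ι) := hσ y (Finset.mem_univ _)
    simp only [hψ₂, hψ₃] at hσ'
    have hrel : ∀ r ∈ FreeGroup.map (.inl ∘ some) '' R ∪
        (Set.range (fun y => (s y)⁻¹ * u y * s y * (u y ^ 2)⁻¹) ∪
          Set.range fun y => v⁻¹ * s y * v * (s y ^ 2)⁻¹), FreeGroup.lift f' r = 1 := by
      simp only [Set.mem_union, or_imp, forall_and, Set.forall_mem_image, Set.forall_mem_range,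
        hmap, map_mul, map_inv, map_pow, mul_inv_eq_one, hu, hu', hlift, v, s,
        FreeGroup.lift_apply_of]
      refine ⟨fun r hr => by simp [hf r hr], fun y => ?_, fun y => ?_⟩
      · have := (hσ' y).1
        rw [map_mul] at this
        exact this
      · exact (hσ' y).2
    refine ⟨U', _, θ.comp φ, f', hrel, hf', ?_⟩
    by_contra! h
    have : FreeGroup.lift f' v = 1 := by
      rw [show FreeGroup.lift f' = 1 by ext i; simp [h i], MonoidHom.one_apply]
    rw [show v = _ from rfl, hmap, hlift, map_eq_one_iff θ hθ, map_eq_one_iff φ hφ] at this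
    exact one_ne_zero (hw 1 (by rw [this, one_zpow]))

theorem exists_trivial_iff (c : ToPartrec.Code) (hc : ∀ n, ∀ w ∈ c.eval [n], w = [0]) :
    ∃ (m : ℕ) (R : Set (FreeGroup (Fin m))) (z x : Fin m), R.Finite ∧
      ∀ n : ℕ, (c.eval [n]).Dom ↔ ∀ (G : Type) [Group G] (f : Fin m → G),
        (∀ r ∈ R, FreeGroup.lift f r = 1) → f z = f x ^ stackCode (trList [n]) → ∀ i, f i = 1 := by
  obtain ⟨ι, _, R, z, x, w, hR, h⟩ := exists_relators_of_code c hc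
  obtain ⟨R', hR', h₁, h₂⟩ := exists_rabin_relators hR w
  let e := Finite.equivFin (Option ι ⊕ Option ι)
  have hmap {G : Type} [Group G] (f : Fin (Nat.card (Option ι ⊕ Option ι)) → G) (r) :
      FreeGroup.lift f (FreeGroup.map e r) = FreeGroup.lift (f ∘ e) r := by
    rw [← MonoidHom.comp_apply]
    congr 1
    ext i
    simp
  refine ⟨_, FreeGroup.map e '' R', e (.inl (some z)), e (.inl (some x)), hR'.image _,
    fun n => ⟨fun hn G _ f hf hz i => ?_, not_imp_not.1 fun hn h' => ?_⟩⟩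
  · simp only [Set.forall_mem_image, hmap] at hf
    obtain ⟨h₃, h₄⟩ := h₁ G _ fun r hr => hf hr
    simpa using h₄ ((h n).1 hn G _ h₃ hz) (e.symm i)
  · obtain ⟨G, _, f, h₃, h₄, h₅⟩ := (h n).2 hn
    obtain ⟨G', _, φ, f', h₆, h₇, i, hi⟩ := h₂ G f h₃ h₅
    refine hi ?_
    have hf' (i) : f' (.inl (some i)) = φ (f i) := congrFun h₇ i
    have hfe : (f' ∘ e.symm) ∘ e = f' := funext fun i => by simp
    simpa using h' G' (f' ∘ e.symm) (by simpa [Set.forall_mem_image, hmap, hfe] using h₆)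
      (by simp [hf', h₄]) (e i)

/-- The stack code of the list `[n]`, computed by recursion on the binary expansion of `n`. -/
def natCode (n : ℕ) : ℕ :=
  if n = 0 then 2 else 3 + n % 2 + 5 * natCode (n / 2)

theorem stackCode_trList_singleton (n : ℕ) : stackCode (trList [n]) = natCode n := by
  have hpos (p : PosNum) : stackCode (trPosNum p ++ [Γ'.cons]) = natCode p := by
    induction p with
    | one => simp [trPosNum, stackCode, digit, natCode]
    | bit0 p ih =>
      have := p.cast_pos (α := ℕ)
      rw [natCode, PosNum.cast_bit0, if_neg (by omega), show ((p : ℕ) + p) / 2 = p by omega, ← ih]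
      simp only [trPosNum, List.cons_append, stackCode, digit]
      omega
    | bit1 p ih =>
      rw [natCode, PosNum.cast_bit1, if_neg (by omega),
        show ((p : ℕ) + p + 1) / 2 = p by omega, ← ih]
      simp only [trPosNum, List.cons_append, stackCode, digit]
      omega
  have hnum (p : Num) : stackCode (trNum p ++ [Γ'.cons]) = natCode p := by
    cases p with
    | zero => simp [trNum, stackCode, digit, natCode]
    | pos p => exact hpos p
  conv_rhs => rw [← Num.to_of_nat n]
  exact hnum n

theorem primrec_natCode : Primrec natCode := by
  have : Primrec₂ fun (_ : Unit) n => natCode n := by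
    refine Primrec.nat_strong_rec _ (g := fun _ l => if l.length = 0 then some 2 else
      (l[l.length / 2]?).map fun c => 3 + l.length % 2 + 5 * c) ?_ fun _ n => ?_
    · have hl : Primrec fun p : Unit × List ℕ => p.2.length := Primrec.list_length.comp .snd
      refine Primrec.ite (c := fun p : Unit × List ℕ => p.2.length = 0)
        (Primrec.eq.comp hl (.const 0)) (.const _) ?_
      refine Primrec.option_map (Primrec.list_getElem?.comp .snd
        (Primrec.nat_div.comp hl (.const 2))) ?_
      have hmod : Primrec fun q : (Unit × List ℕ) × ℕ => q.1.2.length % 2 :=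
        Primrec.nat_mod.comp (hl.comp .fst) (.const 2)
      exact Primrec.nat_add.comp (Primrec.nat_add.comp (.const 3) hmod)
        (Primrec.nat_mul.comp (.const 5) .snd)
    · rw [natCode]
      split_ifs with h <;> simp_all [Nat.div_lt_self, Nat.pos_iff_ne_zero]
  exact this.comp (.const ()) .id

theorem nontrivial_grp_iff (P : FinPres) : Nontrivial P.Grp ↔
    ∃ (G : Type) (_ : Group G) (f : Fin P.1 → G), (∀ r ∈ P.2, FreeGroup.lift f (.mk r) = 1) ∧
      ∃ i, f i ≠ 1 := by
  constructor
  · intro h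
    refine ⟨P.Grp, inferInstance, PresentedGroup.of, fun r hr => ?_, ?_⟩
    · rw [show FreeGroup.lift (PresentedGroup.of (rels := P.rels)) = PresentedGroup.mk P.rels by
        ext i; simp [PresentedGroup.of]]
      exact PresentedGroup.one_of_mem ⟨r, hr, rfl⟩
    · by_contra! h'
      obtain ⟨g, hg⟩ := exists_ne (1 : P.Grp)
      refine hg ?_
      have : MonoidHom.id P.Grp = 1 := PresentedGroup.ext fun i => by simp [h']
      exact congrArg (fun φ => φ g) this
  · rintro ⟨G, _, f, hf, i, hi⟩
    refine ⟨PresentedGroup.of i, 1, fun h => hi ?_⟩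
    have hrel : ∀ r ∈ P.rels, FreeGroup.lift f r = 1 := by
      rintro _ ⟨r, hr, rfl⟩
      exact hf r hr
    simpa using congrArg (PresentedGroup.toGroup hrel) h

theorem exists_code_of_rePred {p : ℕ → Prop} (hp : REPred p) :
    ∃ c : ToPartrec.Code, (∀ n, ∀ w ∈ c.eval [n], w = [0]) ∧ ∀ n, (c.eval [n]).Dom ↔ p n := by
  have h : Partrec fun n => (Part.assert (p n) fun _ => Part.some ()).map fun _ => 0 :=
    hp.map (Computable.const 0).to₂
  obtain ⟨c, hc⟩ := ToPartrec.Code.exists_code (Nat.Partrec'.part_iff₁.2 h)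
  have hc' (n : ℕ) : c.eval [n] =
      pure <$> (Part.assert (p n) fun _ => Part.some ()).map fun _ => 0 := hc (n ::ᵥ .nil)
  refine ⟨c, fun n w hw => ?_, fun n => ?_⟩
  · rw [hc'] at hw
    obtain ⟨a, ha, rfl⟩ := (Part.mem_map_iff _).1 hw
    obtain ⟨_, _, rfl⟩ := (Part.mem_map_iff _).1 ha
    rfl
  · rw [hc']
    exact ⟨fun h => h.1, fun h => ⟨h, trivial⟩⟩

/-- The triviality problem is complete for recursively enumerable predicates. -/
theorem exists_presentations {p : ℕ → Prop} (hp : REPred p) :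
    ∃ P : ℕ → FinPres, Computable (fun n => Encodable.encode (P n)) ∧
      ∀ n, Nontrivial (P n).Grp ↔ ¬ p n := by
  obtain ⟨c, hc, hdom⟩ := exists_code_of_rePred hp
  obtain ⟨m, R, z, x, hR, h⟩ := exists_trivial_iff c hc
  let L : List (Word m) := hR.toFinset.toList.map FreeGroup.toWord
  have hL {G : Type} [Group G] (f : Fin m → G) :
      (∀ r ∈ L, FreeGroup.lift f (.mk r) = 1) ↔ ∀ r ∈ R, FreeGroup.lift f r = 1 := by
    simp [L, FreeGroup.mk_toWord, -FreeGroup.lift_mk]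
  let v : ℕ → Word m := fun n => (z, false) :: (List.range (natCode n)).map fun _ => (x, true)
  have hv : Primrec v := Primrec.list_cons.comp (.const _)
    (Primrec.list_map (Primrec.list_range.comp primrec_natCode) (Primrec.const _).to₂)
  refine ⟨fun n => ⟨m, v n :: L⟩, ?_, fun n => ?_⟩
  · simp only [Encodable.encode_sigma_val, Encodable.encode_list_cons]
    exact (Primrec₂.natPair.comp (.const _) (Primrec.succ.comp
      (Primrec₂.natPair.comp (Primrec.encode.comp hv) (.const _)))).to_comp
  · rw [nontrivial_grp_iff, ← hdom, h]
    push Not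
    simp only [List.forall_mem_cons, hL]
    refine exists_congr fun G => exists_congr fun _ => exists_congr fun f => ?_
    rw [and_assoc, and_left_comm]
    refine and_congr_right fun _ => and_congr_left fun _ => ?_
    rw [stackCode_trList_singleton]
    simp [v, inv_mul_eq_one]

theorem computable_encode_ofFn {k : ℕ} {P : Fin k → ℕ → FinPres}
    (hP : ∀ j, Computable fun n => Encodable.encode (P j n)) :
    Computable fun n => Encodable.encode (List.ofFn fun j => P j n) := by
  induction k with
  | zero => simpa using Computable.const _
  | succ k ih =>
    simp only [List.ofFn_succ, Encodable.encode_list_cons]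
    exact Computable.succ.comp (Primrec₂.natPair.to_comp.comp (hP 0) (ih fun j => hP j.succ))

theorem rePred_exists_eval_ne (k : ℕ) : REPred fun a : ℕ =>
    ∃ i ∈ (Denumerable.ofNat Nat.Partrec.Code a.unpair.2).eval a.unpair.2,
      i ≠ a.unpair.1 ∧ i ≤ k := by
  have h : Partrec fun a : ℕ =>
      ((Denumerable.ofNat Nat.Partrec.Code a.unpair.2).eval a.unpair.2).bind fun i =>
        (↑(if i ≠ a.unpair.1 ∧ i ≤ k then some () else none) : Part Unit) := by
    have h₂ : Primrec fun a : ℕ => a.unpair.2 := Primrec.snd.comp .unpair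
    have h₁ : Primrec fun a : ℕ => a.unpair.1 := Primrec.fst.comp .unpair
    refine (Nat.Partrec.Code.eval_part.comp ((Primrec.ofNat _).comp h₂).to_comp h₂.to_comp).bind
      (Computable.ofOption ?_)
    refine (Primrec.ite (PrimrecPred.and (PrimrecPred.not
      (Primrec.eq.comp .snd (h₁.comp .fst))) (Primrec.nat_le.comp .snd (.const k)))
        (.const _) (.const _)).to_comp
  refine h.dom_re.of_eq fun a => ?_
  simp only [Part.dom_iff_mem, Part.mem_bind_iff, Part.mem_ofOption]
  constructor
  · rintro ⟨_, i, hi, h⟩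
    split_ifs at h with h'
    · exact ⟨i, hi, h'⟩
    · simp at h
  · rintro ⟨i, hi, h'⟩
    exact ⟨(), i, hi, by simp [h']⟩

end TrivialityProblem

/-- Lemma 4.1 (Chiodo): for any `k > 0` there is no algorithm that, on input of a
`(k+1)`-tuple of finite presentations at least one of which presents a nontrivial
group, halts and outputs an index to remove so that among the remaining presentations
at least one still presents a nontrivial group. -/
theorem no_algorithm_removing_presentation (k : ℕ) (hk : 0 < k) :
    ¬ ∃ g : ℕ →. ℕ, Nat.Partrec g ∧
      ∀ ps : Fin (k + 1) → FinPres,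
        (∃ i, Nontrivial (ps i).Grp) →
        ∃ i : Fin (k + 1),
          (i : ℕ) ∈ g (Encodable.encode (List.ofFn ps)) ∧
          ∃ j, j ≠ i ∧ Nontrivial (ps j).Grp := by
  rintro ⟨g, hg, hps⟩
  obtain ⟨P, hP, hnt⟩ := TrivialityProblem.exists_presentations
    (TrivialityProblem.rePred_exists_eval_ne k)
  obtain ⟨c, hc⟩ := Nat.Partrec.Code.exists_code.1 (Partrec.nat_iff.1
    ((Partrec.nat_iff.2 hg).comp (TrivialityProblem.computable_encode_ofFn
      (P := fun (j : Fin (k + 1)) e => P (Nat.pair j e)) fun j =>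
        hP.comp (Primrec₂.natPair.comp (.const _) .id).to_comp)))
  let e := Encodable.encode c
  have hnt' (j : ℕ) : Nontrivial (P (Nat.pair j e)).Grp ↔
      ¬ ∃ i ∈ g (Encodable.encode (List.ofFn fun j : Fin (k + 1) => P (Nat.pair j e))),
        i ≠ j ∧ i ≤ k := by
    rw [hnt]
    simp [e, hc]
  obtain ⟨i, hi, j, hj, hj'⟩ := hps (fun j => P (Nat.pair j e)) <| by
    by_contra h
    rw [not_exists] at h
    obtain ⟨i, hi, hi₀, hik⟩ := not_not.1 (mt (hnt' 0).2 (h 0))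
    obtain ⟨i', hi', hne, -⟩ := not_not.1 (mt (hnt' i).2 (h ⟨i, Nat.lt_succ_of_le hik⟩))
    exact hne (Part.mem_unique hi' hi)
  exact (hnt' j).1 hj' ⟨i, hi, fun h => hj (Fin.ext h.symm), Nat.le_of_lt_succ i.2⟩
end

section
/- Fix any k > 0. There is no algorithm (partial recursive function on codes) that, on input of a code of a finite presentation P = (m, R) whose presented group is nontrivial, halts and outputs a code of a word w : List (Fin m × Bool) of length at most k such that the image of FreeGroup.mk w in the presented group of P is nontrivial (≠ 1). -/
section PatternCoding

/-- Writing the base 5 digit `a` at the end of the `i`-th coordinate of an integer vector. -/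
def pushDigit {κ : Type} [DecidableEq κ] (i : κ) (a : ℕ) (v : κ → ℤ) : κ → ℤ :=
  Function.update v i (5 * v i + a)

/-- Elements `x`, `t`, `r`, `k` of a group satisfying the relations attached to a family `N` of
sets of integer vectors. -/
structure PatternModel {κ : Type} [DecidableEq κ] {G : Type*} [Group G] (N : Set (Set (κ → ℤ)))
    (x : κ → G) (t : N → G) (r : N × N × κ × Fin 5 → G) (k : G) : Prop where
  x_x : ∀ i j, SemiconjBy (x i) (x j) (x j)
  r_x : ∀ (S₁ S₂ : N) (i : κ) (a : Fin 5), (S₁ : Set (κ → ℤ)) = pushDigit i a ⁻¹' S₂ →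
    ∀ j, SemiconjBy (r (S₁, S₂, i, a)) (x j) (x j ^ (if j = i then 5 else 1))
  r_t : ∀ (S₁ S₂ : N) (i : κ) (a : Fin 5), (S₁ : Set (κ → ℤ)) = pushDigit i a ⁻¹' S₂ →
    SemiconjBy (r (S₁, S₂, i, a)) (t S₁) (x i ^ (a : ℕ) * t S₂ * (x i ^ (a : ℕ))⁻¹)
  k_r : ∀ (S₁ S₂ : N) (i : κ) (a : Fin 5), (S₁ : Set (κ → ℤ)) = pushDigit i a ⁻¹' S₂ →
    SemiconjBy k (r (S₁, S₂, i, a)) (r (S₁, S₂, i, a))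
  k_t : ∀ S : N, (0 : κ → ℤ) ∈ (S : Set (κ → ℤ)) → SemiconjBy k (t S) (t S)

namespace PatternModel

variable {κ : Type} [DecidableEq κ] [Fintype κ] {G : Type*} [Group G] {N : Set (Set (κ → ℤ))}
  {x : κ → G} {t : N → G} {r : N × N × κ × Fin 5 → G} {k : G}

/-- The monomial in the commuting elements `x` with a given exponent vector. -/
noncomputable def monomial (h : PatternModel N x t r k) : (κ → Multiplicative ℤ) →* G :=
  MonoidHom.noncommPiCoprod (fun i => zpowersHom G (x i)) fun i j _ m n => by
    simpa using Commute.zpow_zpow (h.x_x i j) m.toAdd n.toAdd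

/-- The conjugate of `t S` by the monomial with exponent vector `v`. -/
noncomputable def marker (h : PatternModel N x t r k) (S : N) (v : κ → ℤ) : G :=
  h.monomial (fun i => Multiplicative.ofAdd (v i)) * t S *
    (h.monomial fun i => Multiplicative.ofAdd (v i))⁻¹

theorem monomial_mulSingle (h : PatternModel N x t r k) (i : κ) (n : Multiplicative ℤ) :
    h.monomial (Pi.mulSingle i n) = x i ^ n.toAdd := by
  refine (MonoidHom.noncommPiCoprod_mulSingle (N := fun _ => Multiplicative ℤ) _ i n).trans ?_
  simp

theorem marker_zero (h : PatternModel N x t r k) (S : N) : h.marker S 0 = t S := by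
  have : (fun i => Multiplicative.ofAdd ((0 : κ → ℤ) i)) = 1 := rfl
  rw [marker, this, map_one]
  simp

theorem marker_single (h : PatternModel N x t r k) (S : N) (i : κ) (n : ℕ) :
    h.marker S (Pi.single i (n : ℤ)) = x i ^ n * t S * (x i ^ n)⁻¹ := by
  have : (fun j => Multiplicative.ofAdd ((Pi.single i (n : ℤ) : κ → ℤ) j)) =
      Pi.mulSingle i (Multiplicative.ofAdd (n : ℤ)) := rfl
  rw [marker, this, monomial_mulSingle]
  simp

theorem conj_monomial (h : PatternModel N x t r k) {S₁ S₂ : N} {i : κ} {a : Fin 5}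
    (hS : (S₁ : Set (κ → ℤ)) = pushDigit i a ⁻¹' S₂) (v : κ → Multiplicative ℤ) :
    r (S₁, S₂, i, a) * h.monomial v * (r (S₁, S₂, i, a))⁻¹ =
      h.monomial fun j => v j ^ (if j = i then 5 else 1) := by
  let D : (κ → Multiplicative ℤ) →* (κ → Multiplicative ℤ) :=
    MonoidHom.pi fun j => (powMonoidHom (if j = i then 5 else 1)).comp (Pi.evalMonoidHom _ j)
  have : (MulAut.conj (r (S₁, S₂, i, a))).toMonoidHom.comp h.monomial = h.monomial.comp D := by
    refine MonoidHom.pi_ext fun j n => ?_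
    have hD : D (Pi.mulSingle j n) = Pi.mulSingle j (n ^ (if j = i then 5 else 1)) := by
      funext l
      change Pi.mulSingle (M := fun _ => Multiplicative ℤ) j n l ^ (if l = i then 5 else 1) = _
      by_cases hl : l = j
      · subst hl
        simp
      · simp [hl]
    simp only [MonoidHom.comp_apply, hD, monomial_mulSingle, MulEquiv.coe_toMonoidHom,
      MulAut.conj_apply]
    have := (h.r_x S₁ S₂ i a hS j).zpow_right n.toAdd
    rw [this.eq, mul_inv_cancel_right, toAdd_pow, ← zpow_natCast, ← zpow_mul]
    simp
  exact DFunLike.congr_fun this v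

theorem conj_marker (h : PatternModel N x t r k) {S₁ S₂ : N} {i : κ} {a : Fin 5}
    (hS : (S₁ : Set (κ → ℤ)) = pushDigit i a ⁻¹' S₂) (v : κ → ℤ) :
    r (S₁, S₂, i, a) * h.marker S₁ v * (r (S₁, S₂, i, a))⁻¹ = h.marker S₂ (pushDigit i a v) := by
  have h1 := h.conj_monomial hS fun i => Multiplicative.ofAdd (v i)
  have h2 := h.r_t S₁ S₂ i a hS
  rw [SemiconjBy, ← mul_inv_eq_iff_eq_mul] at h2
  have h3 : (fun j => Multiplicative.ofAdd (pushDigit i a v j)) =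
      (fun j => Multiplicative.ofAdd (v j) ^ (if j = i then 5 else 1)) *
        Pi.mulSingle i (Multiplicative.ofAdd ((a : ℕ) : ℤ)) := by
    funext j
    by_cases hj : j = i
    · subst hj
      rw [pushDigit, Function.update_self, Pi.mul_apply, Pi.mulSingle_eq_same, if_pos rfl,
        ← ofAdd_nsmul, ← ofAdd_add, nsmul_eq_mul]
      rfl
    · simp [pushDigit, hj]
  rw [marker, marker, h3, map_mul, ← h1, monomial_mulSingle]
  simp only [toAdd_ofAdd, zpow_natCast]
  calc _ = (r (S₁, S₂, i, a) * h.monomial (fun i => Multiplicative.ofAdd (v i)) *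
        (r (S₁, S₂, i, a))⁻¹) * (r (S₁, S₂, i, a) * t S₁ * (r (S₁, S₂, i, a))⁻¹) *
        (r (S₁, S₂, i, a) * h.monomial (fun i => Multiplicative.ofAdd (v i)) *
        (r (S₁, S₂, i, a))⁻¹)⁻¹ := by group
    _ = _ := by
      rw [h2]
      group

theorem commute_marker_iff (h : PatternModel N x t r k) {S₁ S₂ : N} {i : κ} {a : Fin 5}
    (hS : (S₁ : Set (κ → ℤ)) = pushDigit i a ⁻¹' S₂) (v : κ → ℤ) :
    Commute k (h.marker S₁ v) ↔ Commute k (h.marker S₂ (pushDigit i a v)) := by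
  rw [← h.conj_marker hS]
  have hk : Commute k (r (S₁, S₂, i, a)) := h.k_r S₁ S₂ i a hS
  refine ⟨fun H => (hk.mul_right H).mul_right hk.inv_right, fun H => ?_⟩
  have := (hk.inv_right.mul_right H).mul_right hk
  simpa [mul_assoc] using this

end PatternModel

end PatternCoding

section PatternRepresentation

open scoped commutatorElement

variable {κ : Type}

theorem pushDigit_inj [DecidableEq κ] {i : κ} {a b : Fin 5} {u v : κ → ℤ}
    (h : pushDigit i a u = pushDigit i b v) : a = b ∧ u = v := by
  have h1 := congrFun h i
  simp only [pushDigit, Function.update_self] at h1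
  refine ⟨by lia, funext fun j => ?_⟩
  by_cases hj : j = i
  · subst hj
    lia
  · simpa [pushDigit, hj] using congrFun h j

theorem exists_pushDigit_eq [DecidableEq κ] (i : κ) (v : κ → ℤ) : ∃ (a : Fin 5) (u : κ → ℤ), pushDigit i a u = v := by
  refine ⟨⟨(v i % 5).toNat, by lia⟩, Function.update v i (v i / 5), funext fun j => ?_⟩
  by_cases hj : j = i
  · subst hj
    simp [pushDigit]
    lia
  · simp [pushDigit, hj]

/-- A bijective choice of a digit and a parent set, prescribed at one point, such that each set is
the preimage of its parent. -/
theorem exists_parent_equiv [DecidableEq κ] (i : κ) (a : Fin 5) (S₁ S₂ : Set (κ → ℤ))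
    (h : S₁ = pushDigit i a ⁻¹' S₂) :
    ∃ e : Set (κ → ℤ) × List (Fin 5 × Set (κ → ℤ)) ≃
        Fin 5 × Set (κ → ℤ) × List (Fin 5 × Set (κ → ℤ)),
      (∀ c, c.1 = pushDigit i (e c).1 ⁻¹' (e c).2.1) ∧ e (S₁, []) = (a, S₂, []) := by
  classical
  obtain ⟨f, hf, hrel⟩ := Function.Embedding.schroeder_bernstein_of_rel
    (α := Set (κ → ℤ) × List (Fin 5 × Set (κ → ℤ)))
    (β := Fin 5 × Set (κ → ℤ) × List (Fin 5 × Set (κ → ℤ)))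
    (f := fun c => (0, pushDigit i 0 '' c.1, c.2))
    (g := fun d => (pushDigit i d.1 ⁻¹' d.2.1, (d.1, d.2.1) :: d.2.2))
    (by
      rintro ⟨P, l⟩ ⟨P', l'⟩ hc
      simp only [Prod.mk.injEq, true_and] at hc
      have hinj : Function.Injective (pushDigit i 0) := fun u v huv =>
        (pushDigit_inj (a := 0) (b := 0) huv).2
      rw [hinj.image_injective.eq_iff] at hc
      rw [hc.1, hc.2])
    (by
      rintro ⟨ρ, P, l⟩ ⟨ρ', P', l'⟩ hc
      simp only [Prod.mk.injEq, List.cons.injEq] at hc ⊢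
      tauto)
    (fun c d => c.1 = pushDigit i d.1 ⁻¹' d.2.1)
    (fun c => (Set.preimage_image_eq _ fun u v huv =>
        (pushDigit_inj (a := 0) (b := 0) huv).2).symm)
    (fun d => rfl)
  let e := Equiv.ofBijective f hf
  have he : ∀ c, c.1 = pushDigit i (e c).1 ⁻¹' (e c).2.1 := hrel
  refine ⟨e.trans (Equiv.swap (e (S₁, [])) (a, S₂, [])), fun c => ?_, by simp⟩
  rw [Equiv.trans_apply]
  by_cases h1 : e c = e (S₁, [])
  · rw [h1, Equiv.swap_apply_left, e.injective h1]
    exact h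
  by_cases h2 : e c = (a, S₂, [])
  · rw [h2, Equiv.swap_apply_right, ← he (S₁, []), he c, h2]
    exact h.symm
  · rw [Equiv.swap_apply_of_ne_of_ne h1 h2]
    exact he c

/-- An integer vector together with a set of vectors and an auxiliary list. -/
abbrev PatternPoint (κ : Type) : Type :=
  (κ → ℤ) × Set (κ → ℤ) × List (Fin 5 × Set (κ → ℤ))

theorem exists_digit_perm [DecidableEq κ] (i : κ) (a : Fin 5) (S₁ S₂ : Set (κ → ℤ))
    (h : S₁ = pushDigit i a ⁻¹' S₂) :
    ∃ R : Equiv.Perm (PatternPoint κ), (∀ p, (R p).1 ∈ (R p).2.1 ↔ p.1 ∈ p.2.1) ∧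
      (∀ (v : κ → ℤ) c j, R (v + Pi.single j 1, c) =
        ((R (v, c)).1 + Pi.single j (if j = i then 5 else 1), (R (v, c)).2)) ∧
      R (0, S₁, []) = (Pi.single i ((a : ℕ) : ℤ), S₂, []) := by
  obtain ⟨e, he, hbase⟩ := exists_parent_equiv i a S₁ S₂ h
  let R : PatternPoint κ → PatternPoint κ := fun p => (pushDigit i (e p.2).1 p.1, (e p.2).2)
  have hR : Function.Bijective R := by
    refine ⟨?_, ?_⟩
    · rintro ⟨u, c⟩ ⟨v, d⟩ huv
      simp only [R, Prod.mk.injEq] at huv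
      obtain ⟨h1, h2⟩ := pushDigit_inj huv.1
      rw [h2, e.injective (Prod.ext h1 huv.2)]
    · rintro ⟨v, c⟩
      obtain ⟨ρ, u, hu⟩ := exists_pushDigit_eq i v
      exact ⟨(u, e.symm (ρ, c)), by simp [R, hu]⟩
  refine ⟨Equiv.ofBijective R hR, fun p => ?_, fun v c j => ?_, ?_⟩
  · change pushDigit i (e p.2).1 p.1 ∈ (e p.2).2.1 ↔ _
    rw [he p.2, Set.mem_preimage]
  · simp only [Equiv.ofBijective_apply, R, Prod.mk.injEq, and_true]
    funext l
    by_cases hl : l = i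
    · subst hl
      by_cases hj : l = j
      · subst hj
        simp [pushDigit]
        ring
      · simp [pushDigit, hj]
    · by_cases hj : l = j
      · subst hj
        simp [pushDigit, hl]
      · simp [pushDigit, hl, hj]
  · simp only [Equiv.ofBijective_apply, R, hbase, Prod.mk.injEq, and_true]
    funext l
    by_cases hl : l = i
    · subst hl
      simp [pushDigit]
    · simp [pushDigit, hl]

open Classical in
/-- Translation by one on the fibre over `p`. -/
noncomputable def bump (p : PatternPoint κ) : Equiv.Perm (PatternPoint κ × ℚ) :=
  Equiv.prodShear (Equiv.refl _) fun q => if q = p then Equiv.addRight 1 else Equiv.refl _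

/-- The permutation acting through the base. -/
def liftBase (R : Equiv.Perm (PatternPoint κ)) : Equiv.Perm (PatternPoint κ × ℚ) :=
  Equiv.prodShear R fun _ => Equiv.refl _

open Classical in
/-- Doubling in the fibres over points whose vector is not in their set. -/
noncomputable def doubleOutside (κ : Type) : Equiv.Perm (PatternPoint κ × ℚ) :=
  Equiv.prodShear (Equiv.refl _) fun q =>
    if q.1 ∈ q.2.1 then Equiv.refl _ else Equiv.mulRight₀ 2 two_ne_zero

/-- Translation of the vector by a standard basis vector. -/
def shiftVector [DecidableEq κ] (i : κ) : Equiv.Perm (PatternPoint κ) :=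
  Equiv.prodCongr (Equiv.addRight (Pi.single i 1)) (Equiv.refl _)

theorem semiconjBy_bump (R : Equiv.Perm (PatternPoint κ)) (p : PatternPoint κ) :
    SemiconjBy (liftBase R) (bump p) (bump (R p)) := by
  refine Equiv.ext fun q => ?_
  by_cases hq : q.1 = p
  · simp [liftBase, bump, hq]
  · simp [liftBase, bump, hq]

theorem liftBase_mul (R R' : Equiv.Perm (PatternPoint κ)) :
    liftBase (R * R') = liftBase R * liftBase R' := rfl

theorem liftBase_pow (R : Equiv.Perm (PatternPoint κ)) (n : ℕ) :
    liftBase (R ^ n) = liftBase R ^ n := by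
  induction n with
  | zero => rfl
  | succ n ih => rw [pow_succ, pow_succ, liftBase_mul, ih]

theorem shiftVector_pow_apply [DecidableEq κ] (i : κ) (n : ℕ) (p : PatternPoint κ) :
    (shiftVector i ^ n) p = (p.1 + Pi.single i (n : ℤ), p.2) := by
  induction n with
  | zero => simp
  | succ n ih =>
    rw [pow_succ', Equiv.Perm.mul_apply, ih, Nat.cast_succ, Pi.single_add, ← add_assoc]
    rfl

theorem conj_shiftVector_bump [DecidableEq κ] (i : κ) (n : ℕ) (c) :
    liftBase (shiftVector i) ^ n * bump (0, c) * (liftBase (shiftVector i) ^ n)⁻¹ =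
      bump (Pi.single i (n : ℤ), c) := by
  have := semiconjBy_bump (shiftVector i ^ n) (0, c)
  rw [liftBase_pow, shiftVector_pow_apply, zero_add] at this
  exact mul_inv_eq_of_eq_mul this

theorem semiconjBy_doubleOutside_liftBase {R : Equiv.Perm (PatternPoint κ)}
    (hR : ∀ p, (R p).1 ∈ (R p).2.1 ↔ p.1 ∈ p.2.1) :
    SemiconjBy (doubleOutside κ) (liftBase R) (liftBase R) := by
  refine Equiv.ext fun q => ?_
  by_cases hq : q.1.1 ∈ q.1.2.1 <;> simp [doubleOutside, liftBase, hR, hq]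

theorem semiconjBy_doubleOutside_bump {p : PatternPoint κ} (hp : p.1 ∈ p.2.1) :
    SemiconjBy (doubleOutside κ) (bump p) (bump p) := by
  refine Equiv.ext fun q => ?_
  by_cases hq : q.1 = p
  · simp [doubleOutside, bump, hq, hp]
  · simp [doubleOutside, bump, hq]

theorem commutator_doubleOutside_bump {p : PatternPoint κ} (hp : p.1 ∉ p.2.1) (m : ℤ)
    (hm : ⁅doubleOutside κ, bump p⁆ ^ m = 1) : m = 0 := by
  have h (y : ℚ) : ⁅doubleOutside κ, bump p⁆ (p, y) = (p, y + 1) := by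
    simp [commutatorElement_def, doubleOutside, bump, hp, Equiv.Perm.inv_def, Equiv.prodShear]
    ring
  have h' (y : ℚ) : (⁅doubleOutside κ, bump p⁆ ^ m) (p, y) = (p, y + m) := by
    clear hm
    induction m generalizing y with
    | zero => simp
    | succ n ih =>
      rw [zpow_add_one, Equiv.Perm.mul_apply, h, ih]
      push_cast
      ring_nf
    | pred n ih =>
      have h1 : ⁅doubleOutside κ, bump p⁆⁻¹ (p, y) = (p, y - 1) := by
        rw [Equiv.Perm.inv_eq_iff_eq, h, sub_add_cancel]
      rw [zpow_sub_one, Equiv.Perm.mul_apply, h1, ih]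
      push_cast
      ring_nf
  have := h' 0
  rw [hm] at this
  simpa using this.symm

theorem exists_patternModel [DecidableEq κ] (N : Set (Set (κ → ℤ))) :
    ∃ (G : Type) (_ : Group G) (x : κ → G) (t : N → G) (r : N × N × κ × Fin 5 → G) (k : G),
      PatternModel N x t r k ∧ ∀ (S : N) (i : κ) (n : ℕ), Pi.single i (n : ℤ) ∉ (S : Set (κ → ℤ)) →
        ∀ m : ℤ, ⁅k, x i ^ n * t S * (x i ^ n)⁻¹⁆ ^ m = 1 → m = 0 := by
  classical
  choose! R hR using @exists_digit_perm κ _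
  refine ⟨Equiv.Perm (PatternPoint κ × ℚ), inferInstance, fun i => liftBase (shiftVector i),
    fun S => bump (0, (S : Set (κ → ℤ)), []), fun q => liftBase (R q.2.2.1 q.2.2.2 q.1 q.2.1),
    doubleOutside κ, ⟨fun i j => ?_, fun S₁ S₂ i a hS j => ?_, fun S₁ S₂ i a hS => ?_,
      fun S₁ S₂ i a hS => ?_, fun S hS => ?_⟩, fun S i n hn => ?_⟩
  · refine Equiv.ext fun q => ?_
    simp [liftBase, shiftVector, Prod.map, add_right_comm]
  · rw [← liftBase_pow]
    suffices R i a S₁ S₂ * shiftVector j =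
        shiftVector j ^ (if j = i then 5 else 1) * R i a S₁ S₂ from congrArg liftBase this
    refine Equiv.ext fun q => ?_
    rw [Equiv.Perm.mul_apply, Equiv.Perm.mul_apply, shiftVector_pow_apply]
    refine ((hR i a S₁ S₂ hS).2.1 q.1 q.2 j).trans ?_
    split_ifs <;> rfl
  · have := semiconjBy_bump (R i a S₁ S₂) (0, S₁, [])
    rw [(hR i a S₁ S₂ hS).2.2] at this
    rw [conj_shiftVector_bump]
    exact this
  · exact semiconjBy_doubleOutside_liftBase (hR i a S₁ S₂ hS).1
  · exact semiconjBy_doubleOutside_bump hS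
  · rw [conj_shiftVector_bump]
    exact commutator_doubleOutside_bump hn

end PatternRepresentation

section FreePairs

open HNNExtension in
theorem HNNExtension.injective_of_map {G G' : Type*} [Group G] [Group G'] {A B : Subgroup G}
    {φ : A ≃* B} {A' B' : Subgroup G'} {φ' : A' ≃* B'} (f : G →* G')
    (hf : Function.Injective f) (hA : ∀ g, f g ∈ A' → g ∈ A) (hB : ∀ g, f g ∈ B' → g ∈ B)
    (F : HNNExtension G A B φ →* HNNExtension G' A' B' φ') (hof : ∀ g, F (of g) = of (f g))
    (ht : F t = t) : Function.Injective F := by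
  rw [injective_iff_map_eq_one]
  intro x hx
  obtain ⟨d⟩ := NormalWord.TransversalPair.nonempty G A B
  obtain ⟨w, rfl⟩ : ∃ w : NormalWord.ReducedWord G A B, w.prod φ = x :=
    ⟨((NormalWord.equiv φ d) x).toReducedWord, (NormalWord.equiv φ d).left_inv x⟩
  let w' : NormalWord.ReducedWord G' A' B' :=
    { head := f w.head
      toList := w.toList.map fun p => (p.1, f p.2)
      chain := by
        rw [List.isChain_map]
        refine w.chain.imp ?_
        rintro ⟨u, g⟩ ⟨v, h⟩ H hg
        refine H ?_
        rcases Int.units_eq_one_or u with rfl | rfl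
        · exact hA _ hg
        · exact hB _ hg }
  have hw' : w'.prod φ' = F (w.prod φ) := by
    simp only [NormalWord.ReducedWord.prod, w', map_mul, hof, map_list_prod, List.map_map]
    congr 3
    ext p
    simp [hof, ht]
  have hnil : w.toList = [] := by
    have := ReducedWord.toList_eq_nil_of_mem_of_range φ' w'
      ⟨1, by rw [hw', hx, map_one]⟩
    simpa [w'] using this
  have hprod : w.prod φ = of w.head := by simp [NormalWord.ReducedWord.prod, hnil]
  rw [hprod] at hx ⊢
  rw [hof, ← map_one of] at hx
  have := of_injective (φ := φ') hx
  rw [← map_one f] at this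
  rw [hf this, map_one]

theorem zpowersHom_injective {G : Type*} [Group G] (a : G) (ha : ∀ n : ℤ, a ^ n = 1 → n = 0) :
    Function.Injective (zpowersHom G a) := by
  rw [injective_iff_map_eq_one]
  exact fun n hn => ha n.toAdd (by simpa using hn)

/-- Two elements of a group form a free pair if they freely generate a free subgroup. -/
def FreePair {G : Type*} [Group G] (a b : G) : Prop :=
  Function.Injective (FreeGroup.lift fun i : Bool => bif i then a else b)

theorem FreePair.map {G H : Type*} [Group G] [Group H] {a b : G} (h : FreePair a b) (f : G →* H)
    (hf : Function.Injective f) : FreePair (f a) (f b) := by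
  have : FreeGroup.lift (fun i : Bool => bif i then f a else f b) =
      f.comp (FreeGroup.lift fun i : Bool => bif i then a else b) := by
    ext i
    cases i <;> simp
  unfold FreePair
  rw [this]
  exact hf.comp h

theorem FreePair.symm {G : Type*} [Group G] {a b : G} (h : FreePair a b) : FreePair b a := by
  have : FreeGroup.lift (fun i : Bool => bif i then b else a) =
      (FreeGroup.lift fun i : Bool => bif i then a else b).comp
        (FreeGroup.freeGroupCongr Equiv.boolNot).toMonoidHom := by
    ext i
    cases i <;> simp
  unfold FreePair
  rw [this]
  exact h.comp (MulEquiv.injective _)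

open HNNExtension in
theorem HNNExtension.freePair_t_of {G : Type*} [Group G] {A B : Subgroup G} {φ : A ≃* B} (g : G)
    (hg : ∀ n : ℤ, g ^ n = 1 → n = 0) (hA : ∀ n : ℤ, g ^ n ∈ A → n = 0)
    (hB : ∀ n : ℤ, g ^ n ∈ B → n = 0) : FreePair (t : HNNExtension G A B φ) (of g) := by
  let E := HNNExtension (Multiplicative ℤ) ⊥ ⊥ (MulEquiv.refl _)
  let f : Multiplicative ℤ →* G := zpowersHom G g
  let F : E →* HNNExtension G A B φ := lift (of.comp f) t (by
    rintro ⟨a, ha⟩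
    obtain rfl := Subgroup.mem_bot.1 ha
    simp)
  have hF : Function.Injective F := by
    refine injective_of_map f ?_ ?_ ?_ F (fun g => by simp [F]) (by simp [F])
    · exact zpowersHom_injective g hg
    · exact fun n hn => Subgroup.mem_bot.2 (hA n.toAdd (by simpa [f] using hn))
    · exact fun n hn => Subgroup.mem_bot.2 (hB n.toAdd (by simpa [f] using hn))
  have hE : FreePair (t : E) (of (Multiplicative.ofAdd 1)) := by
    let r : E →* FreeGroup Bool := lift (zpowersHom _ (FreeGroup.of false)) (FreeGroup.of true) (by
      rintro ⟨a, ha⟩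
      obtain rfl := Subgroup.mem_bot.1 ha
      simp)
    refine Function.LeftInverse.injective (g := r) fun x => ?_
    rw [← MonoidHom.comp_apply]
    conv_rhs => rw [← MonoidHom.id_apply (FreeGroup Bool) x]
    congr 1
    ext i
    cases i
    · simp only [MonoidHom.comp_apply, FreeGroup.lift_apply_of, cond_false]
      exact (lift_of _ _ _ _).trans (by simp)
    · simp only [MonoidHom.comp_apply, FreeGroup.lift_apply_of, cond_true]
      exact lift_t _ _ _
  simpa [F, f] using hE.map F hF

/-- Powers of an element of infinite order, as isomorphic to powers of another such. -/
noncomputable def zpowersEquiv {G : Type*} [Group G] (a b : G) (ha : ∀ n : ℤ, a ^ n = 1 → n = 0)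
    (hb : ∀ n : ℤ, b ^ n = 1 → n = 0) : (zpowersHom G a).range ≃* (zpowersHom G b).range :=
  (MonoidHom.ofInjective (zpowersHom_injective a ha)).symm.trans
    (MonoidHom.ofInjective (zpowersHom_injective b hb))

theorem zpowersEquiv_self {G : Type*} [Group G] (a b : G) (ha hb) :
    ((zpowersEquiv a b ha hb ⟨a, Multiplicative.ofAdd 1, by simp⟩ : (zpowersHom G b).range) : G)
      = b := by
  have : (⟨a, Multiplicative.ofAdd 1, by simp⟩ : (zpowersHom G a).range) =
      MonoidHom.ofInjective (zpowersHom_injective a ha) (Multiplicative.ofAdd 1) := by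
    ext
    rw [MonoidHom.ofInjective_apply]
    simp
  rw [this, zpowersEquiv, MulEquiv.trans_apply, MulEquiv.symm_apply_apply,
    MonoidHom.ofInjective_apply]
  simp

/-- Adjoining a letter conjugating `a` to `b`. -/
theorem exists_conjugating_extension {G : Type} [Group G] (a b : G)
    (ha : ∀ n : ℤ, a ^ n = 1 → n = 0) (hb : ∀ n : ℤ, b ^ n = 1 → n = 0) :
    ∃ (H : Type) (_ : Group H) (f : G →* H) (t : H), Function.Injective f ∧
      t * f a * t⁻¹ = f b ∧
      ∀ g : G, (∀ n : ℤ, g ^ n = 1 → n = 0) → (∀ m n : ℤ, g ^ m = a ^ n → m = 0) →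
        (∀ m n : ℤ, g ^ m = b ^ n → m = 0) → FreePair t (f g) := by
  refine ⟨HNNExtension G _ _ (zpowersEquiv a b ha hb), inferInstance, HNNExtension.of,
    HNNExtension.t, HNNExtension.of_injective _, ?_, ?_⟩
  · have := HNNExtension.equiv_eq_conj (φ := zpowersEquiv a b ha hb)
      ⟨a, Multiplicative.ofAdd 1, by simp⟩
    rw [zpowersEquiv_self] at this
    exact this.symm
  · intro g hg h1 h2
    refine HNNExtension.freePair_t_of g hg ?_ ?_
    · rintro m ⟨n, hn⟩
      exact h1 m n.toAdd (by simpa using hn.symm)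
    · rintro m ⟨n, hn⟩
      exact h2 m n.toAdd (by simpa using hn.symm)

/-- The family of the two groups in an amalgamated product of two groups. -/
abbrev PairFamily (L M : Type) : Bool → Type
  | true => L
  | false => M

instance (L M : Type) [Group L] [Group M] : ∀ b, Group (PairFamily L M b)
  | true => inferInstanceAs (Group L)
  | false => inferInstanceAs (Group M)

theorem exists_amalgam {F L M : Type} [Group F] [Group L] [Group M] (f : F →* L) (g : F →* M)
    (hf : Function.Injective f) (hg : Function.Injective g) :
    ∃ (N : Type) (_ : Group N) (i : L →* N) (j : M →* N), Function.Injective i ∧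
      Function.Injective j ∧ ∀ x, i (f x) = j (g x) := by
  let φ : ∀ b, F →* PairFamily L M b
    | true => f
    | false => g
  have hφ : ∀ b, Function.Injective (φ b) := by
    rintro (_ | _)
    · exact hg
    · exact hf
  refine ⟨Monoid.PushoutI φ, inferInstance, Monoid.PushoutI.of (φ := φ) true,
    Monoid.PushoutI.of (φ := φ) false, Monoid.PushoutI.of_injective hφ true,
    Monoid.PushoutI.of_injective hφ false, fun x => ?_⟩
  exact (Monoid.PushoutI.of_apply_eq_base φ true x).trans
    (Monoid.PushoutI.of_apply_eq_base φ false x).symm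

theorem FreePair.exists_amalgam {L M : Type} [Group L] [Group M] {a b : L} {c d : M}
    (hL : FreePair a b) (hM : FreePair c d) :
    ∃ (N : Type) (_ : Group N) (i : L →* N) (j : M →* N), Function.Injective i ∧
      Function.Injective j ∧ i a = j c ∧ i b = j d := by
  obtain ⟨N, _, i, j, hi, hj, h⟩ := _root_.exists_amalgam _ _ hL hM
  exact ⟨N, _, i, j, hi, hj, by simpa using h (FreeGroup.of true),
    by simpa using h (FreeGroup.of false)⟩

theorem FreePair.fst_zpow {G : Type*} [Group G] {a b : G} (h : FreePair a b) (m n : ℤ)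
    (hmn : a ^ m = b ^ n) : m = 0 := by
  have h1 : (FreeGroup.of true ^ m : FreeGroup Bool) = FreeGroup.of false ^ n :=
    h (by simpa using hmn)
  have h2 := congrArg (FreeGroup.lift fun i : Bool =>
    bif i then Multiplicative.ofAdd (1 : ℤ) else 1) h1
  simpa [← ofAdd_zsmul] using h2

theorem exists_collapsing_free_pair :
    ∃ (M : Type) (_ : Group M) (p y z w : M), FreePair p w ∧ y * p * y⁻¹ = p ^ 2 ∧
      z * y * z⁻¹ = y ^ 2 ∧ w * z * w⁻¹ = z ^ 2 := by
  have key : FreePair (FreeGroup.of true : FreeGroup Bool) (FreeGroup.of false) := by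
    have : FreeGroup.lift (fun i : Bool => bif i then FreeGroup.of true else FreeGroup.of false) =
        MonoidHom.id _ := by
      ext i
      cases i <;> simp
    unfold FreePair
    rw [this]
    exact Function.injective_id
  have hp : ∀ n : ℤ, (FreeGroup.of true : FreeGroup Bool) ^ n = 1 → n = 0 :=
    fun n hn => key.fst_zpow n 0 (by simpa using hn)
  obtain ⟨C, _, f, y, hf, hy, hyfree⟩ := exists_conjugating_extension
    (FreeGroup.of true : FreeGroup Bool) (FreeGroup.of true ^ 2) hp
    (fun n hn => by
      have := hp (2 * n) (by rw [zpow_mul]; exact hn)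
      lia)
  specialize hyfree (FreeGroup.of false)
    (fun n hn => key.symm.fst_zpow n 0 (by simpa using hn)) (key.symm.fst_zpow)
    (fun m n h => key.symm.fst_zpow m (2 * n) (by rw [zpow_mul]; exact h))
  let a : Equiv.Perm ℚ := Equiv.addRight 1
  let s : Equiv.Perm ℚ := Equiv.mulRight₀ 2 (by norm_num)
  have ha (n : ℤ) : (a ^ n) 0 = n := by simp [a]
  have hs (n : ℤ) (x : ℚ) : (s ^ n) x = x * 2 ^ n := by
    induction n generalizing x with
    | zero => simp
    | succ n ih =>
      rw [zpow_add_one, Equiv.Perm.mul_apply, ih, zpow_add_one₀ two_ne_zero]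
      simp [s]
      ring
    | pred n ih =>
      rw [zpow_sub_one, Equiv.Perm.mul_apply, ih, zpow_sub_one₀ two_ne_zero]
      simp [s, Equiv.Perm.inv_def]
      ring
  have hs1 (n : ℤ) (hn : s ^ n = 1) : n = 0 := by
    have := hs n 1
    rw [hn] at this
    simp only [Equiv.Perm.coe_one, id_eq, one_mul] at this
    exact (zpow_eq_one_iff_right₀ (by norm_num) (by norm_num)).1 this.symm
  have has (m n : ℤ) (h : a ^ m = s ^ n) : m = 0 := by
    have := ha m
    rw [h, hs] at this
    simpa using this.symm
  obtain ⟨B, _, f', w, hf', hw, hwfree⟩ := exists_conjugating_extension s (s ^ 2) hs1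
    (fun n hn => by
      have := hs1 (2 * n) (by rw [zpow_mul]; exact hn)
      lia)
  specialize hwfree a (fun n hn => has n 0 (by simpa using hn)) has
    (fun m n h => has m (2 * n) (by rw [zpow_mul]; exact h))
  obtain ⟨M, _, i, j, hi, hj, h1, h2⟩ := FreePair.exists_amalgam hyfree hwfree.symm
  refine ⟨M, inferInstance, i (f (FreeGroup.of true)), i y, j (f' s), j w, ?_, ?_, ?_, ?_⟩
  · rw [← h2]
    exact (key.map f hf).map i hi
  · rw [← map_mul, ← map_inv, ← map_mul, hy, ← map_pow, ← map_pow]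
  · rw [h1]
    have : s * a * s⁻¹ = a ^ 2 := by
      ext x
      simp [s, a, pow_two, Equiv.Perm.inv_def]
      ring
    rw [← map_mul, ← map_inv, ← map_mul, ← map_pow, ← map_mul, ← map_inv, ← map_mul, this,
      ← map_pow]
  · rw [← map_mul, ← map_inv, ← map_mul, hw, ← map_pow, ← map_pow]

theorem exists_collapsing_extension {L I : Type} [Group L] (p : I → L) (w : L)
    (h : ∀ i, FreePair (p i) w) :
    ∃ (N : Type) (_ : Group N) (f : L →* N) (y z : I → N), Function.Injective f ∧
      ∀ i, y i * f (p i) * (y i)⁻¹ = f (p i) ^ 2 ∧ z i * y i * (z i)⁻¹ = y i ^ 2 ∧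
        f w * z i * (f w)⁻¹ = z i ^ 2 := by
  obtain ⟨M, _, p₀, y, z, w₀, hM, h1, h2, h3⟩ := exists_collapsing_free_pair
  have := fun i => (h i).exists_amalgam hM
  choose N _ f g hf hg hp hw using this
  refine ⟨Monoid.PushoutI f, inferInstance, Monoid.PushoutI.base f,
    fun i => Monoid.PushoutI.of i (g i y), fun i => Monoid.PushoutI.of i (g i z),
    Monoid.PushoutI.base_injective hf, fun i => ?_⟩
  simp only [← Monoid.PushoutI.of_apply_eq_base f i, hp, hw, ← map_mul, ← map_inv, ← map_pow,
    h1, h2, h3, and_self]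

open HNNExtension in
theorem exists_collapsing_extension_of_infinite_order {A I : Type} [Group A] (u : I → A) (w : A)
    (hw : ∀ n : ℤ, w ^ n = 1 → n = 0) :
    ∃ (N : Type) (_ : Group N) (f : A →* N) (x : N) (y z : I → N), Function.Injective f ∧
      ∀ i, y i * (x * f (u i)) * (y i)⁻¹ = (x * f (u i)) ^ 2 ∧ z i * y i * (z i)⁻¹ = y i ^ 2 ∧
        f w * z i * (f w)⁻¹ = z i ^ 2 := by
  let L := HNNExtension A ⊥ ⊥ (MulEquiv.refl _)
  have htw : FreePair (t : L) (of w) := freePair_t_of w hw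
    (fun n hn => hw n (Subgroup.mem_bot.1 hn)) (fun n hn => hw n (Subgroup.mem_bot.1 hn))
  let θ (v : A) : L →* L := lift of (t * of v) (by
    rintro ⟨a, ha⟩
    obtain rfl := Subgroup.mem_bot.1 ha
    simp)
  have hθ (v : A) : Function.Injective (θ v) := by
    refine Function.LeftInverse.injective (g := θ v⁻¹) fun x => ?_
    rw [← MonoidHom.comp_apply]
    conv_rhs => rw [← MonoidHom.id_apply L x]
    congr 1
    ext a
    · simp only [θ, MonoidHom.comp_apply]
      erw [lift_of]
    · simp only [θ, MonoidHom.comp_apply]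
      erw [lift_t, map_mul, lift_t, lift_of]
      simp [mul_assoc]
      rfl
  obtain ⟨N, _, f, y, z, hf, h⟩ := exists_collapsing_extension (fun i => (t : L) * of (u i))
    (of w) (fun i => by simpa [θ] using htw.map (θ (u i)) (hθ (u i)))
  exact ⟨N, _, f.comp of, f t, y, z, hf.comp (of_injective _), fun i => by simpa using h i⟩

end FreePairs

section StackCoding

open Turing StateTransition

variable {A : Type} (d : A → Fin 5)

/-- The base 5 numeral of a stack, with the top of the stack as the least significant digit. -/
def stackCode : List A → ℕ
  | [] => 0
  | a :: l => 5 * stackCode l + d a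

variable {K Λ σ : Type}

/-- The vector of codes of a family of stacks. -/
def stackVector (S : K → List A) : K → ℤ := fun k => (stackCode d (S k) : ℤ)

variable {d}

theorem stackCode_injective (hd : Function.Injective d) (h0 : ∀ a, d a ≠ 0) :
    Function.Injective (stackCode d) := by
  intro l
  induction l with
  | nil =>
    rintro (_ | ⟨b, l'⟩) h
    · rfl
    · have := h0 b
      simp only [stackCode] at h
      lia
  | cons a l ih =>
    rintro (_ | ⟨b, l'⟩) h
    · have := h0 a
      simp only [stackCode] at h
      lia
    · simp only [stackCode] at h
      have h1 : d a = d b := by lia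
      rw [hd h1, ih (by lia : stackCode d l = stackCode d l')]

theorem stackVector_injective (hd : Function.Injective d) (h0 : ∀ a, d a ≠ 0) :
    Function.Injective (stackVector d : (K → List A) → K → ℤ) := fun S T h =>
  funext fun k => stackCode_injective hd h0 (by simpa [stackVector] using congrFun h k)

variable [DecidableEq K]

variable (d) in
theorem pushDigit_stackVector (k : K) (a : A) (S : K → List A) :
    pushDigit k (d a) (stackVector d S) = stackVector d (Function.update S k (a :: S k)) := by
  funext j
  by_cases hj : j = k
  · subst hj
    simp [pushDigit, stackVector, stackCode]
  · simp [pushDigit, stackVector, hj]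

variable (d) in
theorem pushDigit_zero_stackVector {k : K} {S : K → List A} (h : S k = []) :
    pushDigit k (0 : Fin 5) (stackVector d S) = stackVector d S := by
  funext j
  by_cases hj : j = k
  · subst hj
    simp [pushDigit, stackVector, stackCode, h]
  · simp [pushDigit, hj]

theorem exists_of_pushDigit_eq {k : K} {b : Fin 5} {u : K → ℤ} {S : K → List A}
    (h : pushDigit k b u = stackVector d S) :
    (S k = [] ∧ b = 0) ∨
      ∃ a l, S k = a :: l ∧ b = d a ∧ u = stackVector d (Function.update S k l) := by
  have hk := congrFun h k
  simp only [pushDigit, Function.update_self, stackVector] at hk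
  have hu (j) (hj : j ≠ k) : u j = stackVector d S j := by
    simpa [pushDigit, hj] using congrFun h j
  rcases hS : S k with _ | ⟨a, l⟩
  · left
    simp only [hS, stackCode] at hk
    exact ⟨rfl, by lia⟩
  · right
    simp only [hS, stackCode, Nat.cast_add, Nat.cast_mul, Nat.cast_ofNat] at hk
    have hb : b = d a := by
      have h1 := b.isLt
      have h2 := (d a).isLt
      exact Fin.ext (by omega)
    subst hb
    refine ⟨a, l, rfl, rfl, funext fun j => ?_⟩
    by_cases hj : j = k
    · subst hj
      simp only [stackVector, Function.update_self]
      lia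
    · rw [hu j hj]
      simp [stackVector, hj]

theorem preimage_pushDigit_image (hd : Function.Injective d) (h0 : ∀ a, d a ≠ 0) (k : K) (a : A)
    (X : Set (K → List A)) : pushDigit k (d a) ⁻¹' (stackVector d '' X) =
      stackVector d '' {S | Function.update S k (a :: S k) ∈ X} := by
  ext u
  constructor
  · rintro ⟨S, hS, hu⟩
    rcases exists_of_pushDigit_eq hu.symm with ⟨_, h⟩ | ⟨b, l, h1, h2, rfl⟩
    · exact absurd h (h0 a)
    · refine ⟨_, ?_, rfl⟩
      rw [Set.mem_ofPred_eq, Function.update_self, hd h2, ← h1, Function.update_idem,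
        Function.update_eq_self]
      exact hS
  · rintro ⟨S, hS, rfl⟩
    exact ⟨_, hS, (pushDigit_stackVector d k a S).symm⟩

theorem preimage_pushDigit_zero_image (h0 : ∀ a, d a ≠ 0) (k : K) (X : Set (K → List A)) :
    pushDigit k (0 : Fin 5) ⁻¹' (stackVector d '' X) =
      stackVector d '' {S | S k = [] ∧ S ∈ X} := by
  ext u
  constructor
  · rintro ⟨S, hS, hu⟩
    rcases exists_of_pushDigit_eq hu.symm with ⟨h, _⟩ | ⟨b, l, h1, h2, rfl⟩
    · refine ⟨S, ⟨h, hS⟩, ?_⟩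
      rw [← pushDigit_zero_stackVector d h] at hu
      exact (pushDigit_inj hu).2
    · exact absurd h2.symm (h0 b)
  · rintro ⟨S, ⟨hk, hS⟩, rfl⟩
    exact ⟨S, hS, (pushDigit_zero_stackVector d hk).symm⟩

variable (d) in
/-- The codes of the stacks from which a statement leads to a halting computation. -/
def haltSet (M : Λ → TM2.Stmt (fun _ : K => A) Λ σ) (q : TM2.Stmt (fun _ : K => A) Λ σ) (v : σ) :
    Set (K → ℤ) :=
  stackVector d '' {S | (eval (TM2.step M) (TM2.stepAux q v S)).Dom}

variable (d) in
/-- The codes of stacks together with the halting sets of the reachable statements. -/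
def haltSets (M : Λ → TM2.Stmt (fun _ : K => A) Λ σ) (supp : Finset Λ) : Set (Set (K → ℤ)) :=
  insert (Set.range (stackVector d))
    ((fun p : _ × σ => haltSet d M p.1 p.2) '' {p | ∃ l ∈ supp, p.1 ∈ TM2.stmts₁ (M l)})

variable (d) in
/-- The halting sets together with their preimages under pushing a digit. -/
def haltPatterns (M : Λ → TM2.Stmt (fun _ : K => A) Λ σ) (supp : Finset Λ) :
    Set (Set (K → ℤ)) :=
  haltSets d M supp ∪ (fun p : (K × Fin 5) × Set (K → ℤ) => pushDigit p.1.1 p.1.2 ⁻¹' p.2) ''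
    (Set.univ ×ˢ haltSets d M supp)

theorem finite_haltPatterns [Finite K] [Finite σ] (M : Λ → TM2.Stmt (fun _ : K => A) Λ σ)
    (supp : Finset Λ) : (haltPatterns d M supp).Finite := by
  have h : (haltSets d M supp).Finite := by
    refine Set.Finite.insert _ (Set.Finite.image _ ?_)
    have : (⋃ l ∈ supp, (TM2.stmts₁ (M l) : Set (TM2.Stmt (fun _ : K => A) Λ σ))).Finite :=
      Set.Finite.biUnion supp.finite_toSet fun l _ => Finset.finite_toSet _
    refine (this.prod (Set.finite_univ (α := σ))).subset ?_
    rintro ⟨q, v⟩ ⟨l, hl, hq⟩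
    exact ⟨Set.mem_biUnion hl hq, trivial⟩
  exact h.union ((Set.finite_univ.prod h).image _)

/-- A relation between patterns and vectors which follows the digit maps between the patterns in
`N` and holds at the origin. -/
structure Propagates {K : Type} [DecidableEq K] (N : Set (Set (K → ℤ)))
    (Good : Set (K → ℤ) → (K → ℤ) → Prop) : Prop where
  pushDigit_iff : ∀ (S : Set (K → ℤ)) (i : K) (a : Fin 5), pushDigit i a ⁻¹' S ∈ N → S ∈ N →
    ∀ v, Good (pushDigit i a ⁻¹' S) v ↔ Good S (pushDigit i a v)
  zero : ∀ S ∈ N, (0 : K → ℤ) ∈ S → Good S 0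

namespace Propagates

variable {M : Λ → TM2.Stmt (fun _ : K => A) Λ σ} {supp : Finset Λ}
  {Good : Set (K → ℤ) → (K → ℤ) → Prop}

theorem iff_preimage (hG : Propagates (haltPatterns d M supp) Good) {S : Set (K → ℤ)}
    (hS : S ∈ haltSets d M supp) (i : K) (a : Fin 5) (v : K → ℤ) :
    Good S (pushDigit i a v) ↔ Good (pushDigit i a ⁻¹' S) v :=
  (hG.pushDigit_iff S i a (Or.inr ⟨((i, a), S), ⟨trivial, hS⟩, rfl⟩) (Or.inl hS) v).symm

theorem range_stackVector [Fintype K] (hd : Function.Injective d) (h0 : ∀ a, d a ≠ 0)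
    (hG : Propagates (haltPatterns d M supp) Good) (S : K → List A) :
    Good (Set.range (stackVector d)) (stackVector d S) := by
  induction hn : ∑ k, (S k).length generalizing S with
  | zero =>
    have hS : stackVector d S = 0 := by
      funext k
      have := (Finset.sum_eq_zero_iff.1 hn) k (Finset.mem_univ k)
      simp [stackVector, List.length_eq_zero_iff.1 this, stackCode]
    rw [hS]
    exact hG.zero _ (Or.inl (Or.inl rfl)) ⟨S, hS⟩
  | succ n ih =>
    obtain ⟨k, -, hk⟩ := Finset.exists_ne_zero_of_sum_ne_zero (by rw [hn]; exact n.succ_ne_zero)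
    rcases hS : S k with _ | ⟨a, l⟩
    · simp [hS] at hk
    have hSl : S = Function.update (Function.update S k l) k
        (a :: Function.update S k l k) := by simp [← hS]
    have hpre : pushDigit k (d a) ⁻¹' Set.range (stackVector d) =
        Set.range (stackVector d : (K → List A) → K → ℤ) := by
      rw [← Set.image_univ, preimage_pushDigit_image hd h0]
      simp
    rw [hSl, ← pushDigit_stackVector, hG.iff_preimage (Or.inl rfl), hpre]
    refine ih _ ?_
    have h1 := Finset.add_sum_erase Finset.univ (fun j => (S j).length) (Finset.mem_univ k)
    have h2 := Finset.add_sum_erase Finset.univ (fun j => (Function.update S k l j).length)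
      (Finset.mem_univ k)
    have h3 : ∑ j ∈ Finset.univ.erase k, (Function.update S k l j).length =
        ∑ j ∈ Finset.univ.erase k, (S j).length :=
      Finset.sum_congr rfl fun j hj => by rw [Function.update_of_ne (Finset.ne_of_mem_erase hj)]
    simp only [Function.update_self, hS, List.length_cons] at h1 h2
    lia

theorem stmt [Fintype K] (hd : Function.Injective d) (h0 : ∀ a, d a ≠ 0)
    (hG : Propagates (haltPatterns d M supp) Good)
    (q : TM2.Stmt (fun _ : K => A) Λ σ)
    (hq : ∀ q' ∈ TM2.stmts₁ q, ∃ l ∈ supp, q' ∈ TM2.stmts₁ (M l))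
    (hs : TM2.SupportsStmt supp q) (v : σ) (S : K → List A)
    (IH : ∀ l ∈ supp, ∀ v' S', TM2.stepAux q v S = ⟨some l, v', S'⟩ →
      Good (haltSet d M (M l) v') (stackVector d S')) :
    Good (haltSet d M q v) (stackVector d S) := by
  have mem {q'} (h : q' ∈ TM2.stmts₁ q) (w) : haltSet d M q' w ∈ haltSets d M supp :=
    Or.inr ⟨(q', w), hq q' h, rfl⟩
  induction q generalizing v S with
  | push k f q ih =>
    have h1 : haltSet d M (.push k f q) v = pushDigit k (d (f v)) ⁻¹' haltSet d M q v := by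
      rw [haltSet, haltSet, preimage_pushDigit_image hd h0]
      rfl
    have hsub : TM2.stmts₁ q ⊆ TM2.stmts₁ (.push k f q) := by
      simp [TM2.stmts₁]
    rw [h1, ← hG.iff_preimage (mem (hsub TM2.stmts₁_self) v), pushDigit_stackVector]
    exact ih (fun q' h => hq q' (hsub h)) hs v _ IH fun h => mem (hsub h)
  | peek k f q ih =>
    have hsub : TM2.stmts₁ q ⊆ TM2.stmts₁ (.peek k f q) := by
      simp [TM2.stmts₁]
    have key := ih (fun q' h => hq q' (hsub h)) hs _ S IH fun h => mem (hsub h)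
    rcases hS : S k with _ | ⟨a, l⟩
    · have h1 : pushDigit k (0 : Fin 5) ⁻¹' haltSet d M (.peek k f q) v =
          pushDigit k (0 : Fin 5) ⁻¹' haltSet d M q (f v none) := by
        rw [haltSet, haltSet, preimage_pushDigit_zero_image h0, preimage_pushDigit_zero_image h0]
        congr 1
        ext T
        refine and_congr_right fun hT => ?_
        simp [hT]
      rw [← pushDigit_zero_stackVector d hS, hG.iff_preimage (mem TM2.stmts₁_self v), h1,
        ← hG.iff_preimage (mem (hsub TM2.stmts₁_self) _), pushDigit_zero_stackVector d hS]
      simpa [hS] using key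
    · have h1 : pushDigit k (d a) ⁻¹' haltSet d M (.peek k f q) v =
          pushDigit k (d a) ⁻¹' haltSet d M q (f v (some a)) := by
        rw [haltSet, haltSet, preimage_pushDigit_image hd h0, preimage_pushDigit_image hd h0]
        congr 1
        ext T
        simp
      have hSl : S = Function.update (Function.update S k l) k
        (a :: Function.update S k l k) := by simp [← hS]
      rw [hSl, ← pushDigit_stackVector, hG.iff_preimage (mem TM2.stmts₁_self v), h1,
        ← hG.iff_preimage (mem (hsub TM2.stmts₁_self) _), pushDigit_stackVector, ← hSl]
      simpa [hS] using key
  | pop k f q ih =>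
    have hsub : TM2.stmts₁ q ⊆ TM2.stmts₁ (.pop k f q) := by
      simp [TM2.stmts₁]
    have key := ih (fun q' h => hq q' (hsub h)) hs _ _ IH fun h => mem (hsub h)
    rcases hS : S k with _ | ⟨a, l⟩
    · have h1 : pushDigit k (0 : Fin 5) ⁻¹' haltSet d M (.pop k f q) v =
          pushDigit k (0 : Fin 5) ⁻¹' haltSet d M q (f v none) := by
        rw [haltSet, haltSet, preimage_pushDigit_zero_image h0, preimage_pushDigit_zero_image h0]
        congr 1
        ext T
        refine and_congr_right fun hT => ?_
        have : Function.update T k [] = T := by simp [← hT]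
        simp [hT, this]
      have : Function.update S k [] = S := by simp [← hS]
      rw [← pushDigit_zero_stackVector d hS, hG.iff_preimage (mem TM2.stmts₁_self v), h1,
        ← hG.iff_preimage (mem (hsub TM2.stmts₁_self) _), pushDigit_zero_stackVector d hS]
      simpa [hS, this] using key
    · have h1 : pushDigit k (d a) ⁻¹' haltSet d M (.pop k f q) v =
          haltSet d M q (f v (some a)) := by
        rw [haltSet, haltSet, preimage_pushDigit_image hd h0]
        congr 1
        ext T
        simp
      have hSl : S = Function.update (Function.update S k l) k
        (a :: Function.update S k l k) := by simp [← hS]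
      rw [hSl, ← pushDigit_stackVector, hG.iff_preimage (mem TM2.stmts₁_self v), h1]
      simpa [hS] using key
  | load f q ih =>
    have hsub : TM2.stmts₁ q ⊆ TM2.stmts₁ (.load f q) := by
      simp [TM2.stmts₁]
    exact ih (fun q' h => hq q' (hsub h)) hs _ S IH fun h => mem (hsub h)
  | branch f q₁ q₂ ih₁ ih₂ =>
    have hsub₁ : TM2.stmts₁ q₁ ⊆ TM2.stmts₁ (.branch f q₁ q₂) := by
      intro q' h
      simp [TM2.stmts₁, h]
    have hsub₂ : TM2.stmts₁ q₂ ⊆ TM2.stmts₁ (.branch f q₁ q₂) := by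
      intro q' h
      simp [TM2.stmts₁, h]
    have h1 : haltSet d M (.branch f q₁ q₂) v = haltSet d M (cond (f v) q₁ q₂) v := by
      cases hf : f v <;> simp [haltSet, TM2.stepAux, hf]
    rw [h1]
    simp only [TM2.stepAux] at IH
    cases hf : f v <;> rw [hf] at IH
    · exact ih₂ (fun q' h => hq q' (hsub₂ h)) hs.2 v S IH fun h => mem (hsub₂ h)
    · exact ih₁ (fun q' h => hq q' (hsub₁ h)) hs.1 v S IH fun h => mem (hsub₁ h)
  | goto f =>
    have h1 : haltSet d M (.goto f) v = haltSet d M (M (f v)) v := by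
      rw [haltSet, haltSet]
      congr 1
      ext T
      have : eval (TM2.step M) ⟨some (f v), v, T⟩ =
          eval (TM2.step M) (TM2.stepAux (M (f v)) v T) :=
        reaches_eval (Relation.ReflTransGen.single rfl)
      rw [Set.mem_ofPred_eq, Set.mem_ofPred_eq, ← this]
      rfl
    rw [h1]
    exact IH _ (hs v) v S rfl
  | halt =>
    have h1 : haltSet d M .halt v = Set.range (stackVector d) := by
      rw [haltSet, ← Set.image_univ]
      congr 1
      refine Set.eq_univ_of_forall fun T => ?_
      exact Part.dom_iff_mem.2 ⟨_, mem_eval.2 ⟨Relation.ReflTransGen.refl, rfl⟩⟩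
    rw [h1]
    exact hG.range_stackVector hd h0 S

theorem of_dom [Fintype K] (hd : Function.Injective d) (h0 : ∀ a, d a ≠ 0)
    (hG : Propagates (haltPatterns d M supp) Good) (hM : ∀ l ∈ supp, TM2.SupportsStmt supp (M l))
    {l : Λ} (hl : l ∈ supp) {v : σ} {S : K → List A}
    (h : (eval (TM2.step M) ⟨some l, v, S⟩).Dom) :
    Good (haltSet d M (M l) v) (stackVector d S) := by
  obtain ⟨b, hb⟩ := Part.dom_iff_mem.1 h
  suffices ∀ c, b ∈ eval (TM2.step M) c → ∀ l ∈ supp, ∀ v S, c = ⟨some l, v, S⟩ →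
      Good (haltSet d M (M l) v) (stackVector d S) from this _ hb l hl v S rfl
  intro c hc
  refine evalInduction (C := fun c => ∀ l ∈ supp, ∀ v S, c = ⟨some l, v, S⟩ →
      Good (haltSet d M (M l) v) (stackVector d S)) hc ?_
  rintro c - ih l hl v S rfl
  exact hG.stmt hd h0 (M l) (fun q' h => ⟨l, hl, h⟩) (hM l hl) v S fun l' hl' v' S' h' =>
    ih _ rfl l' hl' v' S' h'

end Propagates

theorem stackVector_mem_haltSet (hd : Function.Injective d) (h0 : ∀ a, d a ≠ 0)
    {M : Λ → TM2.Stmt (fun _ : K => A) Λ σ} {l : Λ} {v : σ} {S : K → List A} :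
    stackVector d S ∈ haltSet d M (M l) v ↔ (eval (TM2.step M) ⟨some l, v, S⟩).Dom := by
  have : eval (TM2.step M) ⟨some l, v, S⟩ = eval (TM2.step M) (TM2.stepAux (M l) v S) :=
    reaches_eval (Relation.ReflTransGen.single rfl)
  rw [haltSet, (stackVector_injective hd h0).mem_set_image, Set.mem_ofPred_eq, this]

theorem haltSet_mem_haltPatterns (M : Λ → TM2.Stmt (fun _ : K => A) Λ σ) {supp : Finset Λ} {l : Λ}
    (hl : l ∈ supp) (v : σ) : haltSet d M (M l) v ∈ haltPatterns d M supp :=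
  Or.inl (Or.inr ⟨(M l, v), ⟨l, hl, TM2.stmts₁_self⟩, rfl⟩)

end StackCoding

section PatternRelators

variable {κ : Type} [DecidableEq κ]

/-- The generators of the finitely presented group attached to a family of patterns. -/
abbrev PatternGen (N : Set (Set (κ → ℤ))) : Type :=
  κ ⊕ N ⊕ (N × N × κ × Fin 5) ⊕ Unit

/-- The relator expressing that `a * b = c * a`. -/
def semiconjRelator {α : Type} (a b c : FreeGroup α) : FreeGroup α :=
  a * b * (c * a)⁻¹

theorem map_semiconjRelator_eq_one_iff {α G : Type} [Group G] (φ : FreeGroup α →* G)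
    (a b c : FreeGroup α) :
    φ (semiconjRelator a b c) = 1 ↔ SemiconjBy (φ a) (φ b) (φ c) := by
  rw [semiconjRelator, map_mul, map_inv, mul_inv_eq_one, map_mul, map_mul, SemiconjBy]

/-- The quadruples of two patterns, a coordinate and a digit such that the first pattern is the
preimage of the second one. -/
abbrev PatternArrow (N : Set (Set (κ → ℤ))) : Type :=
  {q : N × N × κ × Fin 5 // (q.1 : Set (κ → ℤ)) = pushDigit q.2.2.1 q.2.2.2 ⁻¹' q.2.1}

open FreeGroup in
/-- The relators expressing that the generators form a `PatternModel`. -/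
def patternRelators (N : Set (Set (κ → ℤ))) : Set (FreeGroup (PatternGen N)) :=
  let x : κ → FreeGroup (PatternGen N) := fun i => of (.inl i)
  let t : N → FreeGroup (PatternGen N) := fun S => of (.inr (.inl S))
  let r : PatternArrow N → FreeGroup (PatternGen N) := fun q => of (.inr (.inr (.inl q)))
  let k : FreeGroup (PatternGen N) := of (.inr (.inr (.inr ())))
  Set.range (fun p : κ × κ => semiconjRelator (x p.1) (x p.2) (x p.2)) ∪
  Set.range (fun p : PatternArrow N × κ =>
    semiconjRelator (r p.1) (x p.2) (x p.2 ^ (if p.2 = p.1.1.2.2.1 then 5 else 1))) ∪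
  Set.range (fun q : PatternArrow N => semiconjRelator (r q) (t q.1.1)
    (x q.1.2.2.1 ^ (q.1.2.2.2 : ℕ) * t q.1.2.1 * (x q.1.2.2.1 ^ (q.1.2.2.2 : ℕ))⁻¹)) ∪
  Set.range (fun q : PatternArrow N => semiconjRelator k (r q) (r q)) ∪
  Set.range (fun S : {S : N // (0 : κ → ℤ) ∈ (S : Set (κ → ℤ))} =>
    semiconjRelator k (t S) (t S))

theorem finite_patternRelators [Finite κ] {N : Set (Set (κ → ℤ))} (hN : N.Finite) :
    (patternRelators N).Finite := by
  have := hN.to_subtype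
  simp only [patternRelators, Set.finite_union]
  exact ⟨⟨⟨⟨Set.finite_range _, Set.finite_range _⟩, Set.finite_range _⟩, Set.finite_range _⟩,
    Set.finite_range _⟩

theorem forall_patternRelators_iff {N : Set (Set (κ → ℤ))} {G : Type} [Group G]
    (φ : PatternGen N → G) : (∀ r ∈ patternRelators N, FreeGroup.lift φ r = 1) ↔
      PatternModel N (fun i => φ (.inl i)) (fun S => φ (.inr (.inl S)))
        (fun q => φ (.inr (.inr (.inl q)))) (φ (.inr (.inr (.inr ())))) := by
  simp only [patternRelators, Set.union_def, Set.mem_ofPred_eq, or_imp, forall_and,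
    Set.forall_mem_range, map_semiconjRelator_eq_one_iff, FreeGroup.lift_apply_of, map_mul,
    map_pow, map_inv]
  constructor
  · rintro ⟨⟨⟨⟨h1, h2⟩, h3⟩, h4⟩, h5⟩
    exact ⟨fun i j => h1 (i, j), fun S₁ S₂ i a h j => h2 (⟨(S₁, S₂, i, a), h⟩, j),
      fun S₁ S₂ i a h => h3 ⟨(S₁, S₂, i, a), h⟩, fun S₁ S₂ i a h => h4 ⟨(S₁, S₂, i, a), h⟩,
      fun S h => h5 ⟨S, h⟩⟩
  · intro h
    exact ⟨⟨⟨⟨fun p => h.x_x _ _, fun p => h.r_x _ _ _ _ p.1.2 _⟩, fun q => h.r_t _ _ _ _ q.2⟩,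
      fun q => h.k_r _ _ _ _ q.2⟩, fun S => h.k_t _ S.2⟩

theorem PatternModel.propagates [Fintype κ] {N : Set (Set (κ → ℤ))} {G : Type} [Group G]
    {x : κ → G} {t : N → G} {r : N × N × κ × Fin 5 → G} {k : G} (h : PatternModel N x t r k) :
    Propagates N fun S v => ∃ hS : S ∈ N, Commute k (h.marker ⟨S, hS⟩ v) where
  pushDigit_iff S i a h₁ h₂ v := by
    rw [exists_prop_of_true h₁, exists_prop_of_true h₂]
    exact h.commute_marker_iff (S₁ := ⟨_, h₁⟩) (S₂ := ⟨S, h₂⟩) rfl v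
  zero S hS h₀ := ⟨hS, by
    rw [h.marker_zero]
    exact h.k_t ⟨S, hS⟩ h₀⟩

end PatternRelators

section InputCode

open Turing PartrecToTM2

/-- The base 5 digit of a stack symbol. -/
def symbolDigit : Γ' → Fin 5
  | .consₗ => 1
  | .cons => 2
  | .bit0 => 3
  | .bit1 => 4

theorem symbolDigit_injective : Function.Injective symbolDigit := by
  intro a b
  cases a <;> cases b <;> simp [symbolDigit]

theorem symbolDigit_ne_zero (a : Γ') : symbolDigit a ≠ 0 := by
  cases a <;> simp [symbolDigit]

instance : Fintype K' :=
  ⟨{.main, .rev, .aux, .stack}, fun k => by cases k <;> simp⟩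

/-- The code of the stack containing the number `n`. -/
def inputCode (n : ℕ) : ℕ :=
  if n = 0 then 2 else 5 * inputCode (n / 2) + (n % 2 + 3)
decreasing_by lia

theorem inputCode_bit (n b : ℕ) (hb : b < 2) (h : 0 < n + b) :
    inputCode (2 * n + b) = 5 * inputCode n + (b + 3) := by
  rw [inputCode, if_neg (by lia), (by lia : (2 * n + b) / 2 = n),
    (by lia : (2 * n + b) % 2 = b)]

theorem stackCode_trPosNum (p : PosNum) :
    stackCode symbolDigit (trPosNum p ++ [Γ'.cons]) = inputCode p := by
  induction p with
  | one =>
    rw [inputCode, inputCode]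
    simp [trPosNum, stackCode, symbolDigit]
  | bit0 p ih =>
    have h := inputCode_bit p 0 (by lia) p.cast_pos
    have h2 : ((PosNum.bit0 p : PosNum) : ℕ) = 2 * p + 0 := by
      rw [PosNum.cast_bit0]
      lia
    rw [h2, h, ← ih]
    simp [trPosNum, stackCode, symbolDigit]
  | bit1 p ih =>
    have h := inputCode_bit p 1 (by lia) (by lia)
    have h2 : ((PosNum.bit1 p : PosNum) : ℕ) = 2 * p + 1 := by
      rw [PosNum.cast_bit1]
      lia
    rw [h2, h, ← ih]
    simp [trPosNum, stackCode, symbolDigit]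

theorem stackCode_trList (n : ℕ) : stackCode symbolDigit (trList [n]) = inputCode n := by
  have h : ((n : Num) : ℕ) = n := Num.to_of_nat n
  rw [trList, trList, trNat]
  cases hn : (n : Num) with
  | zero =>
    rw [hn] at h
    rw [← h]
    change _ = inputCode 0
    rw [inputCode]
    simp [trNum, stackCode, symbolDigit]
  | pos p =>
    rw [hn] at h
    rw [← h]
    exact stackCode_trPosNum p

theorem primrec_inputCode : Primrec inputCode := by
  have h : Primrec₂ fun (_ : Unit) (n : ℕ) => inputCode n := by
    refine Primrec.nat_strong_rec _ (g := fun _ l => some (if l.length = 0 then 2 else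
      5 * l.getD (l.length / 2) 0 + (l.length % 2 + 3))) ?_ ?_
    · refine Primrec.option_some.comp (Primrec.ite ?_ (Primrec.const 2) ?_)
      · exact Primrec.eq.comp (Primrec.list_length.comp Primrec.snd) (Primrec.const 0)
      · have hl : Primrec fun p : Unit × List ℕ => p.2.length :=
          Primrec.list_length.comp Primrec.snd
        refine Primrec.nat_add.comp (Primrec.nat_mul.comp (Primrec.const 5) ?_)
          (Primrec.nat_add.comp (Primrec.nat_mod.comp hl (Primrec.const 2)) (Primrec.const 3))
        exact (Primrec.list_getD 0).comp Primrec.snd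
          (Primrec.nat_div.comp hl (Primrec.const 2))
    · intro _ n
      rw [inputCode]
      rcases Nat.eq_zero_or_pos n with rfl | hn
      · simp
      · have : n / 2 < n := Nat.div_lt_self hn one_lt_two
        simp [this]
  exact h.comp (Primrec.const ()) Primrec.id

theorem stackVector_trList (n : ℕ) :
    stackVector symbolDigit (K'.elim (trList [n]) [] [] []) =
      Pi.single K'.main (inputCode n : ℤ) := by
  funext k
  cases k
  · simpa [stackVector, K'.elim] using stackCode_trList n
  all_goals simp [stackVector, K'.elim, stackCode]

open scoped commutatorElement

/-- A recursively enumerable predicate is expressed by the triviality of commutators in a finitely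
presented group, and the nontrivial ones have infinite order. -/
theorem REPred.exists_commutator_reduction {p : ℕ → Prop} (hp : REPred p) :
    ∃ (α : Type) (R : Set (FreeGroup α)) (k x t : α) (f : ℕ → ℕ),
      Finite α ∧ R.Finite ∧ Computable f ∧ ∀ n,
        (p n → ∀ (G : Type) [Group G] (φ : α → G), (∀ r ∈ R, FreeGroup.lift φ r = 1) →
          ⁅φ k, φ x ^ f n * φ t * (φ x ^ f n)⁻¹⁆ = 1) ∧
        (¬ p n → ∃ (G : Type) (_ : Group G) (φ : α → G), (∀ r ∈ R, FreeGroup.lift φ r = 1) ∧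
          ∀ m : ℤ, ⁅φ k, φ x ^ f n * φ t * (φ x ^ f n)⁻¹⁆ ^ m = 1 → m = 0) := by
  obtain ⟨c, hc⟩ : ∃ c : ToPartrec.Code, ∀ n : ℕ, (c.eval [n]).Dom ↔ p n := by
    have h : Partrec fun n : ℕ => (Part.assert (p n) fun _ => Part.some 0 : Part ℕ) := by
      exact hp.map (Computable.const 0).to₂ |>.of_eq fun n => Part.ext fun m => by simp [eq_comm]
    obtain ⟨c, hc⟩ := ToPartrec.Code.exists_code (Nat.Partrec'.part_iff₁.2 h)
    refine ⟨c, fun n => ?_⟩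
    rw [show [n] = (n ::ᵥ List.Vector.nil).1 from rfl, hc]
    simp [Part.assert]
  let supp := codeSupp c Cont'.halt
  have hsupp := tr_supports c Cont'.halt
  let l := trNormal c Cont'.halt
  let M : Λ' → TM2.Stmt (fun _ : K' => Γ') Λ' (Option Γ') := tr
  let N := haltPatterns symbolDigit M supp
  have hN : N.Finite := finite_haltPatterns M supp
  have := hN.to_subtype
  let T : N := ⟨haltSet symbolDigit M (M l) none, haltSet_mem_haltPatterns M hsupp.1 none⟩
  have hdom (n : ℕ) : (StateTransition.eval (TM2.step M)
      ⟨some l, none, K'.elim (trList [n]) [] [] []⟩).Dom ↔ p n := by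
    rw [← hc]
    have : (StateTransition.eval (TM2.step tr) (init c [n])).Dom ↔ (c.eval [n]).Dom := by
      rw [tr_eval]
      rfl
    exact this
  refine ⟨PatternGen N, patternRelators N, .inr (.inr (.inr ())), .inl .main, .inr (.inl T),
    inputCode, inferInstance, finite_patternRelators hN, primrec_inputCode.to_comp, fun n => ?_⟩
  constructor
  · intro hn G _ φ hφ
    have hm := (forall_patternRelators_iff φ).1 hφ
    obtain ⟨hS, h⟩ := hm.propagates.of_dom symbolDigit_injective symbolDigit_ne_zero hsupp.2
      hsupp.1 ((hdom n).2 hn)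
    rw [stackVector_trList, hm.marker_single] at h
    exact commutatorElement_eq_one_iff_commute.2 h
  · intro hn
    obtain ⟨G, _, x, t, r, k, hm, h⟩ := exists_patternModel N
    refine ⟨G, inferInstance, Sum.elim x (Sum.elim t (Sum.elim r fun _ => k)),
      (forall_patternRelators_iff _).2 hm, h T .main (inputCode n) fun hmem => hn ?_⟩
    rw [← stackVector_trList] at hmem
    exact (hdom n).1 ((stackVector_mem_haltSet symbolDigit_injective symbolDigit_ne_zero).1 hmem)

end InputCode

section CollapsingPresentation

theorem SemiconjBy.eq_one_of_one_left {G : Type*} [Group G] {a : G}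
    (h : SemiconjBy 1 a (a ^ 2)) : a = 1 := by
  have h := h.eq
  rw [one_mul, mul_one, pow_two] at h
  exact left_eq_mul.1 h

theorem SemiconjBy.eq_one_of_sq {G : Type*} [Group G] {a b : G} (h : SemiconjBy b a (a ^ 2))
    (hb : b = 1) : a = 1 :=
  SemiconjBy.eq_one_of_one_left (hb ▸ h)

/-- The generators of the presentation which collapses when a given word of the generators `α`
is trivial. -/
abbrev CollapseGen (α : Type) : Type :=
  α ⊕ Bool ⊕ Bool × Option α

open FreeGroup in
/-- The relators, other than the one depending on the word, of the collapsing presentation. -/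
def collapseRelators {α : Type} (R : Set (FreeGroup α)) : Set (FreeGroup (CollapseGen α)) :=
  let p : Option α → FreeGroup (CollapseGen α) := fun o =>
    of (.inr (.inl false)) * o.elim 1 fun a => of (.inl a)
  let y : Option α → FreeGroup (CollapseGen α) := fun o => of (.inr (.inr (false, o)))
  let z : Option α → FreeGroup (CollapseGen α) := fun o => of (.inr (.inr (true, o)))
  FreeGroup.map Sum.inl '' R ∪
  Set.range (fun o => semiconjRelator (y o) (p o) (p o ^ 2)) ∪
  Set.range (fun o => semiconjRelator (z o) (y o) (y o ^ 2)) ∪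
  Set.range (fun o => semiconjRelator (of (.inr (.inl true))) (z o) (z o ^ 2))

theorem finite_collapseRelators {α : Type} [Finite α] {R : Set (FreeGroup α)} (hR : R.Finite) :
    (collapseRelators R).Finite := by
  simp only [collapseRelators, Set.finite_union]
  exact ⟨⟨⟨hR.image _, Set.finite_range _⟩, Set.finite_range _⟩, Set.finite_range _⟩

theorem forall_collapseRelators_iff {α G : Type} [Group G] {R : Set (FreeGroup α)}
    (φ : CollapseGen α → G) : (∀ r ∈ collapseRelators R, FreeGroup.lift φ r = 1) ↔
      (∀ r ∈ R, FreeGroup.lift (fun a => φ (.inl a)) r = 1) ∧ ∀ o : Option α,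
        SemiconjBy (φ (.inr (.inr (false, o))))
          (φ (.inr (.inl false)) * o.elim 1 fun a => φ (.inl a))
          ((φ (.inr (.inl false)) * o.elim 1 fun a => φ (.inl a)) ^ 2) ∧
        SemiconjBy (φ (.inr (.inr (true, o)))) (φ (.inr (.inr (false, o))))
          (φ (.inr (.inr (false, o))) ^ 2) ∧
        SemiconjBy (φ (.inr (.inl true))) (φ (.inr (.inr (true, o))))
          (φ (.inr (.inr (true, o))) ^ 2) := by
  have hmap : (FreeGroup.lift φ).comp (FreeGroup.map Sum.inl) =
      FreeGroup.lift fun a => φ (.inl a) := by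
    ext a
    simp
  have helim (o : Option α) : FreeGroup.lift φ
      (o.elim 1 fun a => FreeGroup.of (.inl a)) = o.elim 1 fun a => φ (.inl a) := by
    cases o <;> simp
  simp only [collapseRelators, Set.union_def, Set.mem_ofPred_eq, or_imp, forall_and,
    Set.forall_mem_range, Set.forall_mem_image, map_semiconjRelator_eq_one_iff,
    FreeGroup.lift_apply_of, map_mul, map_pow, helim, and_assoc, ← hmap, MonoidHom.comp_apply]

theorem eq_one_of_collapseRelators {α G : Type} [Group G] {R : Set (FreeGroup α)}
    {φ : CollapseGen α → G} (h : ∀ r ∈ collapseRelators R, FreeGroup.lift φ r = 1)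
    (hω : φ (.inr (.inl true)) = 1) (i : CollapseGen α) : φ i = 1 := by
  have H := ((forall_collapseRelators_iff φ).1 h).2
  have hz o := (H o).2.2.eq_one_of_sq hω
  have hy o := (H o).2.1.eq_one_of_sq (hz o)
  have hp o := (H o).1.eq_one_of_sq (hy o)
  have hx : φ (.inr (.inl false)) = 1 := by simpa using hp none
  rcases i with a | (_ | _) | ⟨_ | _, o⟩
  · simpa [hx] using hp (some a)
  · exact hx
  · exact hω
  · exact hy o
  · exact hz o

/-- The word `ω⁻¹ * ⁅k, x ^ n * t * (x ^ n)⁻¹⁆`. -/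
def commutatorWord {α : Type} (ω k x t : α) (n : ℕ) : List (α × Bool) :=
  [(ω, false), (k, true)] ++ List.replicate n (x, true) ++ [(t, true)] ++
    List.replicate n (x, false) ++ [(k, false)] ++ List.replicate n (x, true) ++ [(t, false)] ++
    List.replicate n (x, false)

open scoped commutatorElement

theorem lift_commutatorWord {α G : Type} [Group G] (φ : α → G) (ω k x t : α) (n : ℕ) :
    FreeGroup.lift φ (FreeGroup.mk (commutatorWord ω k x t n)) =
      (φ ω)⁻¹ * ⁅φ k, φ x ^ n * φ t * (φ x ^ n)⁻¹⁆ := by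
  simp [commutatorWord, FreeGroup.lift_mk, commutatorElement_def, mul_assoc]

theorem primrec_commutatorWord {α : Type} [Primcodable α] (ω k x t : α) :
    Primrec (commutatorWord ω k x t) := by
  have h (a : α × Bool) : Primrec fun n : ℕ => List.replicate n a :=
    (Primrec.list_map Primrec.list_range (Primrec.const a).to₂).of_eq fun n => by
      simp [List.map_const']
  have H {f : ℕ → List (α × Bool)} (hf : Primrec f) (l : List (α × Bool)) :
      Primrec fun n => f n ++ l := Primrec.list_append.comp hf (Primrec.const l)
  exact Primrec.list_append.comp (H (Primrec.list_append.comp (H (Primrec.list_append.comp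
    (H (Primrec.list_append.comp (Primrec.const _) (h _)) _) (h _)) _) (h _)) _) (h _)

open Classical in
/-- Triviality of finitely presented groups which differ in a single relator is as hard as any
recursively enumerable predicate. -/
theorem REPred.exists_triviality_reduction {p : ℕ → Prop} (hp : REPred p) :
    ∃ (M : ℕ) (R : List (Word M)) (v : ℕ → Word M), Computable v ∧ ∀ n,
      (p n → ∀ (G : Type) [Group G] (φ : Fin M → G),
        (∀ r ∈ v n :: R, FreeGroup.lift φ (FreeGroup.mk r) = 1) → ∀ i, φ i = 1) ∧
      (¬ p n → ∃ (G : Type) (_ : Group G) (φ : Fin M → G),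
        (∀ r ∈ v n :: R, FreeGroup.lift φ (FreeGroup.mk r) = 1) ∧ ∃ i, φ i ≠ 1) := by
  obtain ⟨α, R, k, x, t, f, hα, hR, hf, H⟩ := hp.exists_commutator_reduction
  obtain ⟨M, ⟨e⟩⟩ := Finite.exists_equiv_fin (CollapseGen α)
  have hR' := finite_collapseRelators hR
  let ω : CollapseGen α := .inr (.inl true)
  let v (n : ℕ) : Word M := commutatorWord (e ω) (e (.inl k)) (e (.inl x)) (e (.inl t)) (f n)
  let R' : List (Word M) :=
    hR'.toFinset.toList.map fun r => r.toWord.map fun a => (e a.1, a.2)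
  have key {G : Type} [Group G] (φ : Fin M → G) (n : ℕ) :
      (∀ r ∈ v n :: R', FreeGroup.lift φ (FreeGroup.mk r) = 1) ↔
      φ (e ω) = ⁅φ (e (.inl k)), φ (e (.inl x)) ^ f n * φ (e (.inl t)) *
        (φ (e (.inl x)) ^ f n)⁻¹⁆ ∧
      ∀ r ∈ collapseRelators R, FreeGroup.lift (φ ∘ e) r = 1 := by
    have h (r : FreeGroup (CollapseGen α)) : FreeGroup.lift φ
        (FreeGroup.mk (r.toWord.map fun a => (e a.1, a.2))) = FreeGroup.lift (φ ∘ e) r := by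
      conv_rhs => rw [← FreeGroup.mk_toWord (x := r)]
      rw [FreeGroup.lift_mk, FreeGroup.lift_mk, List.map_map]
      rfl
    simp only [List.forall_mem_cons, List.forall_mem_map, h, Finset.mem_toList,
      Set.Finite.mem_toFinset, v, R', lift_commutatorWord, inv_mul_eq_one]
  refine ⟨M, R', v, (primrec_commutatorWord _ _ _ _).to_comp.comp hf, fun n => ⟨?_, ?_⟩⟩
  · intro hn G _ φ hφ
    obtain ⟨h1, h2⟩ := (key φ n).1 hφ
    have h3 := (H n).1 hn G (fun a => φ (e (.inl a))) ((forall_collapseRelators_iff _).1 h2).1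
    intro i
    obtain ⟨j, rfl⟩ := e.surjective i
    exact eq_one_of_collapseRelators h2 (h1.trans h3) j
  · intro hn
    obtain ⟨A, _, φ, hφ, hw⟩ := (H n).2 hn
    obtain ⟨G, _, g, X, y, z, hg, h⟩ := exists_collapsing_extension_of_infinite_order
      (fun o : Option α => o.elim 1 φ) _ hw
    let ψ : CollapseGen α → G := Sum.elim (g ∘ φ) (Sum.elim
      (fun b => cond b (g ⁅φ k, φ x ^ f n * φ t * (φ x ^ f n)⁻¹⁆) X)
      fun q => cond q.1 (z q.2) (y q.2))
    have hψ (i) : (ψ ∘ e.symm) (e i) = ψ i := by simp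
    refine ⟨G, inferInstance, ψ ∘ e.symm, (key _ n).2 ⟨?_, ?_⟩, e ω, ?_⟩
    · simp only [hψ]
      simp [ψ, ω, map_commutatorElement]
    · have h0 : (ψ ∘ e.symm) ∘ e = ψ := funext hψ
      rw [h0, forall_collapseRelators_iff]
      constructor
      · intro r hr
        have : FreeGroup.lift (fun a => ψ (.inl a)) = g.comp (FreeGroup.lift φ) := by
          ext a
          simp [ψ]
        rw [this, MonoidHom.comp_apply, hφ r hr, map_one]
      · intro o
        have ho : (o.elim 1 fun a => ψ (.inl a)) = g (o.elim 1 φ) := by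
          cases o <;> simp [ψ]
        rw [ho]
        simp only [SemiconjBy, ← mul_inv_eq_iff_eq_mul]
        exact h o
    · rw [hψ]
      intro h1
      have := hw 1
      rw [zpow_one] at this
      exact one_ne_zero (this (hg (h1.trans (map_one g).symm)))

end CollapsingPresentation

section BlockPresentation

theorem FinPres.proj_eq_one_of_letters (P : FinPres) (w : Word P.1)
    (h : ∀ a ∈ w, P.proj (FreeGroup.of a.1) = 1) : P.proj (FreeGroup.mk w) = 1 := by
  induction w with
  | nil => exact map_one P.proj
  | cons a w ih =>
    have hof : (FreeGroup.mk (a :: w) : FreeGroup (Fin P.1)) =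
        cond a.2 (FreeGroup.of a.1) (FreeGroup.of a.1)⁻¹ * FreeGroup.mk w := by
      obtain ⟨i, b⟩ := a
      cases b <;> rfl
    rw [hof, map_mul, ih fun b hb => h b (List.mem_cons_of_mem a hb), mul_one]
    have := h a List.mem_cons_self
    cases a.2 <;> simp [this]

theorem FinPres.proj_rel (P : FinPres) {r : Word P.1} (hr : r ∈ P.2) :
    P.proj (FreeGroup.mk r) = 1 :=
  PresentedGroup.one_of_mem ⟨r, hr, rfl⟩

theorem FinPres.nontrivial_of_model (P : FinPres) {G : Type} [Group G] (φ : Fin P.1 → G)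
    (hφ : ∀ r ∈ P.2, FreeGroup.lift φ (FreeGroup.mk r) = 1) {i : Fin P.1} (hi : φ i ≠ 1) :
    Nontrivial P.Grp := by
  have h : ∀ r ∈ P.rels, FreeGroup.lift φ r = 1 := by
    rintro _ ⟨r, hr, rfl⟩
    exact hφ r hr
  refine ⟨PresentedGroup.of i, 1, fun h1 => hi ?_⟩
  rw [← PresentedGroup.toGroup.of h (x := i), h1, map_one]

/-- The word over the `j`-th block of generators corresponding to a word. -/
def blockWord {m M : ℕ} (j : Fin m) (r : Word M) : Word (m * M) :=
  r.map fun a => (finProdFinEquiv (j, a.1), a.2)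

theorem lift_blockWord {m M : ℕ} {G : Type*} [Group G] (φ : Fin (m * M) → G) (j : Fin m)
    (r : Word M) : FreeGroup.lift φ (FreeGroup.mk (blockWord j r)) =
      FreeGroup.lift (fun i => φ (finProdFinEquiv (j, i))) (FreeGroup.mk r) := by
  rw [FreeGroup.lift_mk, FreeGroup.lift_mk, blockWord, List.map_map]
  rfl

theorem primrec_blockWord {m M : ℕ} (j : Fin m) :
    Primrec (blockWord j : Word M → Word (m * M)) :=
  Primrec.list_map Primrec.id
    ((Primrec.dom_finite fun a : Fin M × Bool =>
      (finProdFinEquiv (j, a.1), a.2)).comp Primrec.snd).to₂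

/-- The presentation of the free product of the groups presented by the relators `B j`. -/
def blockPres {m M : ℕ} (B : Fin m → List (Word M)) : FinPres :=
  ⟨m * M, (List.finRange m).flatMap fun j => (B j).map (blockWord j)⟩

theorem forall_mem_blockPres {m M : ℕ} {B : Fin m → List (Word M)} {p : Word (m * M) → Prop} :
    (∀ r ∈ (blockPres B).2, p r) ↔ ∀ j, ∀ r ∈ B j, p (blockWord j r) := by
  refine ⟨fun h j r hr => h _ (List.mem_flatMap.2
    ⟨j, List.mem_finRange j, List.mem_map_of_mem hr⟩), fun h r hr => ?_⟩
  obtain ⟨j, -, hj⟩ := List.mem_flatMap.1 hr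
  obtain ⟨s, hs, rfl⟩ := List.mem_map.1 hj
  exact h j s hs

theorem blockPres_proj_eq_one {m M : ℕ} {B : Fin m → List (Word M)} {j : Fin m}
    (h : ∀ (G : Type) [Group G] (φ : Fin M → G),
      (∀ r ∈ B j, FreeGroup.lift φ (FreeGroup.mk r) = 1) → ∀ i, φ i = 1) (i : Fin M) :
    (blockPres B).proj (FreeGroup.of (finProdFinEquiv (j, i) : Fin (m * M))) = 1 := by
  refine h _ (fun i => (blockPres B).proj (FreeGroup.of (finProdFinEquiv (j, i) : Fin (m * M))))
    (fun r hr => ?_) i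
  rw [← lift_blockWord fun i => (blockPres B).proj (FreeGroup.of i)]
  have := (blockPres B).proj_rel
    (forall_mem_blockPres.1 (fun _ h => h : ∀ r ∈ (blockPres B).2, r ∈ (blockPres B).2) j r hr)
  rw [← this]
  refine DFunLike.congr_fun (?_ : FreeGroup.lift _ = (blockPres B).proj) _
  ext i
  exact FreeGroup.lift_apply_of

theorem nontrivial_blockPres {m M : ℕ} {B : Fin m → List (Word M)} {j : Fin m}
    (h : ∃ (G : Type) (_ : Group G) (φ : Fin M → G),
      (∀ r ∈ B j, FreeGroup.lift φ (FreeGroup.mk r) = 1) ∧ ∃ i, φ i ≠ 1) :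
    Nontrivial (blockPres B).Grp := by
  obtain ⟨G, _, φ, hφ, i, hi⟩ := h
  let ψ : Fin (m * M) → G := fun a =>
    if (finProdFinEquiv.symm a).1 = j then φ (finProdFinEquiv.symm a).2 else 1
  have hψ (j' i) : ψ (finProdFinEquiv (j', i)) = if j' = j then φ i else 1 := by
    simp only [ψ, Equiv.symm_apply_apply]
  have key (j') (r) (hr : r ∈ B j') : FreeGroup.lift ψ (FreeGroup.mk (blockWord j' r)) = 1 := by
    rw [lift_blockWord]
    by_cases hj : j' = j
    · subst hj
      simpa only [hψ, if_true] using hφ r hr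
    · have : FreeGroup.lift (fun i => ψ (finProdFinEquiv (j', i))) = 1 := by
        ext i
        simp [hψ, hj]
      rw [this, MonoidHom.one_apply]
  refine (blockPres B).nontrivial_of_model ψ (forall_mem_blockPres.2 key)
    (i := finProdFinEquiv (j, i)) ?_
  rw [hψ, if_pos rfl]
  exact hi

theorem computable_flatMap {ι α β : Type*} [Primcodable α] [Primcodable β] (l : List ι)
    {F : ι → α → List β} (hF : ∀ j, Computable (F j)) :
    Computable fun a => l.flatMap fun j => F j a := by
  induction l with
  | nil => exact Computable.const []
  | cons j l ih => exact Computable.list_append.comp (hF j) ih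

theorem computable_encode_blockPres {m M : ℕ} {α : Type*} [Primcodable α]
    {v : Fin m → α → Word M} (hv : ∀ j, Computable (v j)) (R : List (Word M)) :
    Computable fun a => Encodable.encode (blockPres fun j => v j a :: R) := by
  have h : Computable fun a => (List.finRange m).flatMap fun j =>
      (v j a :: R).map (blockWord j : Word M → Word (m * M)) :=
    computable_flatMap _ fun j => Computable.list_cons.comp
      ((primrec_blockWord j).to_comp.comp (hv j)) (Computable.const _)
  exact Primrec₂.natPair.to_comp.comp (Computable.const (m * M)) (Computable.encode.comp h)

theorem encode_map_val {m : ℕ} (w : Word m) :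
    Encodable.encode (w.map fun a => ((a.1 : ℕ), a.2)) = Encodable.encode w := by
  induction w with
  | nil => rfl
  | cons a w ih =>
    rw [List.map_cons, Encodable.encode_list_cons, Encodable.encode_list_cons, ih]
    rfl

/-- The blocks of generators of size `M` met by a coded word, if its length is at most `k`. -/
def codedBlocks (k M y : ℕ) : List ℕ :=
  let l := (Encodable.decode (α := List (ℕ × Bool)) y).getD []
  if l.length ≤ k then l.map fun a => a.1 / M else []

theorem length_codedBlocks_le (k M y : ℕ) : (codedBlocks k M y).length ≤ k := by
  rw [codedBlocks]
  split_ifs with h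
  · simpa using h
  · exact Nat.zero_le k

theorem codedBlocks_encode {k M m : ℕ} {w : Word m} (hw : w.length ≤ k) :
    codedBlocks k M (Encodable.encode w) = w.map fun a => (a.1 : ℕ) / M := by
  rw [codedBlocks, ← encode_map_val, Encodable.encodek]
  simp [hw]

theorem primrec_codedBlocks (k M : ℕ) : Primrec (codedBlocks k M) := by
  have h : Primrec fun y : ℕ => (Encodable.decode (α := List (ℕ × Bool)) y).getD [] :=
    Primrec.option_getD.comp Primrec.decode (Primrec.const [])
  refine Primrec.ite (Primrec.nat_le.comp (Primrec.list_length.comp h) (Primrec.const k))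
    (Primrec.list_map h ?_) (Primrec.const [])
  exact (Primrec.nat_div.comp (Primrec.fst.comp Primrec.snd) (Primrec.const M)).to₂

theorem exists_notMem_of_length_le {k : ℕ} {l : List ℕ} (h : l.length ≤ k) :
    ∃ j : Fin (k + 1), (j : ℕ) ∉ l := by
  by_contra! H
  have h1 : Finset.range (k + 1) ⊆ l.toFinset := fun j hj =>
    List.mem_toFinset.2 (H ⟨j, Finset.mem_range.1 hj⟩)
  have h2 := (Finset.card_le_card h1).trans l.toFinset_card_le
  rw [Finset.card_range] at h2
  lia

/-- A program which knows its own code `c` and halts on `j` if and only if `g (u c)` is defined and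
its value `y` satisfies `j ∈ b y`. -/
theorem exists_code_dom_iff_mem {g : ℕ →. ℕ} (hg : Nat.Partrec g) {u : ℕ → ℕ}
    (hu : Computable u) {b : ℕ → List ℕ} (hb : Primrec b) :
    ∃ c : Nat.Partrec.Code, ∀ j, (c.eval j).Dom ↔ ∃ y ∈ g (u (Encodable.encode c)), j ∈ b y := by
  have hmem : Computable fun q : (Nat.Partrec.Code × ℕ) × ℕ => decide (q.1.2 ∈ b q.2) := by
    have h : PrimrecPred fun q : (Nat.Partrec.Code × ℕ) × ℕ => ∃ a ∈ b q.2, a = q.1.2 :=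
      Primrec.eq.exists_mem_list.comp (hb.comp Primrec.snd) (Primrec.snd.comp Primrec.fst)
    refine (PrimrecPred.decide (h.of_eq fun q => ?_)).to_comp
    simp
  have hf : Partrec₂ fun (c : Nat.Partrec.Code) (j : ℕ) =>
      (g (u (Encodable.encode c))).bind fun y =>
        cond (decide (j ∈ b y)) (Part.some 0) (Part.none : Part ℕ) :=
    Partrec.bind ((Partrec.nat_iff.2 hg).comp (hu.comp (Computable.encode.comp Computable.fst)))
      (Partrec.cond hmem (Computable.const 0).partrec Partrec.none).to₂
  obtain ⟨c, hc⟩ := Nat.Partrec.Code.fixed_point₂ hf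
  refine ⟨c, fun j => ?_⟩
  rw [hc, Part.bind_dom]
  constructor
  · rintro ⟨h, h'⟩
    refine ⟨_, Part.get_mem h, ?_⟩
    by_contra hj
    simp [hj] at h'
  · rintro ⟨y, hy, hj⟩
    refine ⟨Part.dom_iff_mem.2 ⟨y, hy⟩, ?_⟩
    rw [Part.get_eq_of_mem hy]
    simp [hj]

end BlockPresentation

/-- Theorem A (Chiodo): for any `k > 0` there is no algorithm that, on input of a finite
presentation of a nontrivial group, halts and outputs a word of length at most `k`
which is nontrivial in the presented group. -/
theorem no_algorithm_bounded_nontrivial_word (k : ℕ) (hk : 0 < k) :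
    ¬ ∃ g : ℕ →. ℕ, Nat.Partrec g ∧
      ∀ P : FinPres, Nontrivial P.Grp →
        ∃ w : Word P.1,
          Encodable.encode w ∈ g (Encodable.encode P) ∧
          w.length ≤ k ∧ P.proj (FreeGroup.mk w) ≠ 1 := by
  rintro ⟨g, hg, H⟩
  have hre : REPred fun n : ℕ =>
      ((Denumerable.ofNat Nat.Partrec.Code n.unpair.1).eval n.unpair.2).Dom :=
    (Nat.Partrec.Code.eval_part.comp
      ((Computable.ofNat _).comp (Computable.fst.comp Computable.unpair))
      (Computable.snd.comp Computable.unpair)).dom_re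
  obtain ⟨M, R, v, hv, hvR⟩ := hre.exists_triviality_reduction
  let B (e : ℕ) (j : Fin (k + 1)) : List (Word M) := v (Nat.pair e j) :: R
  have hcomp : Computable fun e => Encodable.encode (blockPres (B e)) :=
    computable_encode_blockPres (fun j => hv.comp
      (Primrec₂.natPair.to_comp.comp Computable.id (Computable.const (j : ℕ)))) R
  obtain ⟨c, hc⟩ := exists_code_dom_iff_mem hg hcomp (primrec_codedBlocks k M)
  have hdom (j : ℕ) : ((Denumerable.ofNat Nat.Partrec.Code
      (Nat.pair (Encodable.encode c) j).unpair.1).eval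
      (Nat.pair (Encodable.encode c) j).unpair.2).Dom ↔ (c.eval j).Dom := by
    simp
  have hnt : Nontrivial (blockPres (B (Encodable.encode c))).Grp := by
    have : ∃ j : Fin (k + 1), ¬ (c.eval j).Dom := by
      by_contra! hall
      obtain ⟨y, hy, -⟩ := (hc 0).1 (hall 0)
      obtain ⟨j, hj⟩ := exists_notMem_of_length_le (length_codedBlocks_le k M y)
      obtain ⟨y', hy', hj'⟩ := (hc j).1 (hall j)
      rw [Part.mem_unique hy' hy] at hj'
      exact hj hj'
    obtain ⟨j, hj⟩ := this
    exact nontrivial_blockPres ((hvR _).2 (mt (hdom j).1 hj))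
  obtain ⟨w, hw, hlen, hne⟩ := H _ hnt
  refine hne (FinPres.proj_eq_one_of_letters _ w fun a ha => ?_)
  obtain ⟨⟨j, i⟩, hij⟩ := finProdFinEquiv.surjective (a.1 : Fin ((k + 1) * M))
  have hj : (a.1 : ℕ) / M = j := by
    have := i.isLt
    rw [← hij]
    change ((i : ℕ) + M * j) / M = j
    rw [Nat.add_mul_div_left _ _ (by lia), Nat.div_eq_of_lt i.isLt, zero_add]
  have hmem : (j : ℕ) ∈ codedBlocks k M (Encodable.encode w) := by
    rw [codedBlocks_encode hlen, List.mem_map]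
    exact ⟨a, ha, hj⟩
  rw [← hij]
  exact blockPres_proj_eq_one ((hvR _).1 ((hdom j).2 ((hc j).2 ⟨_, hw, hmem⟩))) i
end
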